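/- Let c, c' > 0 and suppose φ : Ω_c → Ω⁻_{c'} is a biholomorphism from the forward Short ℂ², Ω_c = {G⁺_H < c}, onto the backward Short ℂ², Ω⁻_{c'} = {G⁻_H < c'}. Then φ maps the forward non-escaping set onto the backward non-escaping set: φ(K⁺) = K⁻. -/

import Mathlib

open Filter Topology Set

noncomputable section

/-- `f : U → V` and `g : V → U` are mutually inverse holomorphic maps, i.e.
`f` is a biholomorphism from `U` onto `V` with inverse `g`. -/
def IsBiholoOn (f g : ℂ × ℂ → ℂ × ℂ) (U V : Set (ℂ × ℂ)) : Prop :=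
  DifferentiableOn ℂ f U ∧ DifferentiableOn ℂ g V ∧
    Set.MapsTo f U V ∧ Set.MapsTo g V U ∧
    (∀ z ∈ U, g (f z) = z) ∧ (∀ w ∈ V, f (g w) = w)

namespace HenonAux

section

/-- `w` is, locally uniformly on `Ω`, a limit of functions `k * log ‖F‖`, `F` holomorphic. -/
def UL (w : ℂ × ℂ → ℝ) (Ω : Set (ℂ × ℂ)) : Prop :=
  ∀ Q ⊆ Ω, IsCompact Q → ∀ ε > 0, ∃ (k : ℝ) (F : ℂ × ℂ → (ℂ × ℂ) × ℂ),
    0 < k ∧ DifferentiableOn ℂ F Ω ∧ (∀ z, 1 ≤ ‖F z‖) ∧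
    ∀ z ∈ Q, |w z - k * Real.log ‖F z‖| ≤ ε

lemma UL.comp {w : ℂ × ℂ → ℝ} {Ω Ω' : Set (ℂ × ℂ)} (h : UL w Ω) {Φ : ℂ × ℂ → ℂ × ℂ}
    (hΦ : DifferentiableOn ℂ Φ Ω') (hm : MapsTo Φ Ω' Ω) : UL (fun z => w (Φ z)) Ω' := by
  intro Q hQ hQc ε hε
  obtain ⟨k, F, hk, hF, h1, h2⟩ := h (Φ '' Q) (by
    rintro _ ⟨z, hz, rfl⟩; exact hm (hQ hz)) (hQc.image_of_continuousOn
      (hΦ.continuousOn.mono hQ)) ε hε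
  exact ⟨k, F ∘ Φ, hk, hF.comp hΦ hm, fun z => h1 _, fun z hz => h2 _ (mem_image_of_mem _ hz)⟩

lemma UL.maxP {w : ℂ × ℂ → ℝ} {Ω : Set (ℂ × ℂ)} (h : UL w Ω) {g : ℂ → ℂ × ℂ}
    (hg : Differentiable ℂ g) {U : Set ℂ} (hU : Bornology.IsBounded U)
    (hm : MapsTo g (closure U) Ω) {B : ℝ} (hB : ∀ ζ ∈ frontier U, w (g ζ) ≤ B)
    {ζ : ℂ} (hζ : ζ ∈ U) : w (g ζ) ≤ B := by
  refine le_of_forall_pos_le_add fun ε hε => ?_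
  have hc : IsCompact (closure U) := hU.isCompact_closure
  obtain ⟨k, F, hk, hF, h1, h2⟩ := h (g '' closure U) (by
    rintro _ ⟨z, hz, rfl⟩; exact hm hz) (hc.image hg.continuous) (ε / 2) (by positivity)
  have hd : DiffContOnCl ℂ (F ∘ g) U :=
    (hF.comp hg.differentiableOn hm).diffContOnCl
  have key : ‖(F ∘ g) ζ‖ ≤ Real.exp ((B + ε / 2) / k) := by
    refine Complex.norm_le_of_forall_mem_frontier_norm_le hU hd (fun x hx => ?_)
      (subset_closure hζ)
    have hx1 := abs_le.1 (h2 (g x) (mem_image_of_mem _ (frontier_subset_closure hx)))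
    have hx2 := hB x hx
    have hp : 0 < ‖F (g x)‖ := lt_of_lt_of_le one_pos (h1 _)
    rw [Function.comp_apply, ← Real.log_le_iff_le_exp hp, le_div_iff₀ hk]
    linarith
  have hp : 0 < ‖F (g ζ)‖ := lt_of_lt_of_le one_pos (h1 _)
  rw [Function.comp_apply, ← Real.log_le_iff_le_exp hp, le_div_iff₀ hk] at key
  have hx1 := abs_le.1 (h2 (g ζ) (mem_image_of_mem _ (subset_closure hζ)))
  linarith

open Complex.HadamardThreeLines in
lemma UL.threeC {w : ℂ × ℂ → ℝ} {Ω : Set (ℂ × ℂ)} (h : UL w Ω) {g : ℂ → ℂ × ℂ}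
    (hg : Differentiable ℂ g) {r1 r3 : ℝ} (h1 : 0 < r1) (h3 : r1 < r3)
    (hm : MapsTo g (Metric.closedBall 0 r3) Ω) {m1 m3 : ℝ}
    (hm1 : ∀ ζ : ℂ, ‖ζ‖ = r1 → w (g ζ) ≤ m1) (hm3 : ∀ ζ : ℂ, ‖ζ‖ = r3 → w (g ζ) ≤ m3)
    {ζ : ℂ} (hζ1 : r1 ≤ ‖ζ‖) (hζ3 : ‖ζ‖ ≤ r3) :
    w (g ζ) ≤ m1 + (m3 - m1) * (Real.log (‖ζ‖ / r1) / Real.log (r3 / r1)) := by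
  have hr3 : 0 < r3 := h1.trans h3
  have hζ0 : 0 < ‖ζ‖ := h1.trans_le hζ1
  rw [Real.log_div hζ0.ne' h1.ne', Real.log_div hr3.ne' h1.ne']
  set θ := (Real.log ‖ζ‖ - Real.log r1) / (Real.log r3 - Real.log r1) with hθ
  refine le_of_forall_pos_le_add fun ε hε => ?_
  obtain ⟨k, F, hk, hF, hF1, hF2⟩ := h (g '' Metric.closedBall 0 r3) (by
    rintro _ ⟨z, hz, rfl⟩; exact hm hz) ((isCompact_closedBall _ _).image hg.continuous)
    (ε / 2) (by positivity)
  have hl : Real.log r1 < Real.log r3 := Real.log_lt_log h1 h3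
  have hexp : Differentiable ℂ (fun s : ℂ => g (Complex.exp s)) := hg.comp Complex.differentiable_exp
  have hmaps : MapsTo (fun s : ℂ => Complex.exp s)
      (verticalClosedStrip (Real.log r1) (Real.log r3)) (Metric.closedBall 0 r3) := by
    intro s hs
    simp only [verticalClosedStrip, mem_preimage, mem_Icc] at hs
    rw [mem_closedBall_zero_iff, Complex.norm_exp, ← Real.le_log_iff_exp_le hr3]
    exact hs.2
  have hdiff : DifferentiableOn ℂ (fun s : ℂ => F (g (Complex.exp s)))
      (verticalClosedStrip (Real.log r1) (Real.log r3)) :=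
    hF.comp hexp.differentiableOn (fun s hs => hm (hmaps hs))
  have hcl : closure (verticalStrip (Real.log r1) (Real.log r3)) ⊆
      verticalClosedStrip (Real.log r1) (Real.log r3) := by
    apply closure_minimal
    · exact preimage_mono Ioo_subset_Icc_self
    · exact isClosed_Icc.preimage Complex.continuous_re
  have hdc : DiffContOnCl ℂ (fun s : ℂ => F (g (Complex.exp s)))
      (verticalStrip (Real.log r1) (Real.log r3)) := (hdiff.mono hcl).diffContOnCl
  have hB : BddAbove ((norm ∘ fun s : ℂ => F (g (Complex.exp s))) ''
      verticalClosedStrip (Real.log r1) (Real.log r3)) := by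
    have : BddAbove ((fun ζ => ‖F (g ζ)‖) '' Metric.closedBall 0 r3) := by
      apply IsCompact.bddAbove_image (isCompact_closedBall _ _)
      exact (hF.comp hg.differentiableOn hm).continuousOn.norm
    refine this.mono ?_
    rintro _ ⟨s, hs, rfl⟩
    exact ⟨Complex.exp s, hmaps hs, rfl⟩
  have hbd : ∀ (r m : ℝ), 0 < r → r ≤ r3 → (∀ ζ : ℂ, ‖ζ‖ = r → w (g ζ) ≤ m) →
      ∀ s ∈ Complex.re ⁻¹' {Real.log r}, ‖(fun s : ℂ => F (g (Complex.exp s))) s‖ ≤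
        Real.exp ((m + ε / 2) / k) := by
    intro r m hr hr3' hmm s hs
    simp only [mem_preimage, mem_singleton_iff] at hs
    have hn : ‖Complex.exp s‖ = r := by rw [Complex.norm_exp, hs, Real.exp_log hr]
    have hx1 := abs_le.1 (hF2 (g (Complex.exp s)) (mem_image_of_mem _ (by
      rw [mem_closedBall_zero_iff, hn]; exact hr3')))
    have hx2 := hmm _ hn
    have hp : 0 < ‖F (g (Complex.exp s))‖ := lt_of_lt_of_le one_pos (hF1 _)
    rw [← Real.log_le_iff_le_exp hp, le_div_iff₀ hk]
    linarith
  have hζne : ζ ≠ 0 := norm_pos_iff.1 hζ0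
  have key := norm_le_interp_of_mem_verticalClosedStrip' (z := Complex.log ζ) hl (by
      simp only [verticalClosedStrip, mem_preimage, mem_Icc, Complex.log_re]
      exact ⟨Real.log_le_log h1 hζ1, Real.log_le_log hζ0 hζ3⟩) hdc hB
      (hbd r1 m1 h1 h3.le hm1) (hbd r3 m3 hr3 le_rfl hm3)
  simp only [Complex.log_re, Complex.exp_log hζne] at key
  rw [← hθ, ← Real.exp_mul, ← Real.exp_mul, ← Real.exp_add] at key
  have hp : 0 < ‖F (g ζ)‖ := lt_of_lt_of_le one_pos (hF1 _)
  rw [← Real.log_le_iff_le_exp hp] at key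
  have hx1 := abs_le.1 (hF2 (g ζ) (mem_image_of_mem _ (by
      rw [mem_closedBall_zero_iff]; exact hζ3)))
  have e : k * ((m1 + ε / 2) / k * (1 - θ) + (m3 + ε / 2) / k * θ) =
      m1 + (m3 - m1) * θ + ε / 2 := by
    field_simp; ring
  have := mul_le_mul_of_nonneg_left key hk.le
  rw [e] at this
  linarith

end

end HenonAux

namespace HenonAux

section

lemma poly_bound (q : Polynomial ℂ) (m : ℕ) (hq : q.natDegree ≤ m) :
    ∃ A : ℝ, 0 < A ∧ ∀ M : ℝ, 1 ≤ M → ∀ y : ℂ, ‖y‖ ≤ M → ‖q.eval y‖ ≤ A * M ^ m := by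
  refine ⟨∑ i ∈ Finset.range (m + 1), ‖q.coeff i‖ + 1, by positivity, fun M hM y hy => ?_⟩
  rw [Polynomial.eval_eq_sum_range' (Nat.lt_succ_of_le hq)]
  refine (norm_sum_le _ _).trans ?_
  have hM0 : 0 ≤ M := by linarith
  rw [add_mul, Finset.sum_mul]
  refine le_add_of_le_of_nonneg (Finset.sum_le_sum fun i hi => ?_) (by positivity)
  rw [norm_mul, norm_pow]
  refine mul_le_mul_of_nonneg_left ?_ (norm_nonneg _)
  calc ‖y‖ ^ i ≤ M ^ i := pow_le_pow_left₀ (norm_nonneg _) hy i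
    _ ≤ M ^ m := pow_le_pow_right₀ hM (by simpa [Nat.lt_succ_iff] using hi)

lemma poly_lead (q : Polynomial ℂ) (m : ℕ) (hq : q.natDegree ≤ m + 1) :
    ∃ A : ℝ, 0 < A ∧ ∀ y : ℂ, 1 ≤ ‖y‖ →
      ‖q.eval y - q.coeff (m + 1) * y ^ (m + 1)‖ ≤ A * ‖y‖ ^ m := by
  refine ⟨∑ i ∈ Finset.range (m + 1), ‖q.coeff i‖ + 1, by positivity, fun y hy => ?_⟩
  rw [Polynomial.eval_eq_sum_range' (Nat.lt_succ_of_le hq), Finset.sum_range_succ,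
    add_sub_cancel_right]
  refine (norm_sum_le _ _).trans ?_
  rw [add_mul, Finset.sum_mul]
  refine le_add_of_le_of_nonneg (Finset.sum_le_sum fun i hi => ?_) (by positivity)
  rw [norm_mul, norm_pow]
  refine mul_le_mul_of_nonneg_left ?_ (norm_nonneg _)
  exact pow_le_pow_right₀ hy (by simpa [Nat.lt_succ_iff] using hi)

lemma poly_lip (q : Polynomial ℂ) (m : ℕ) (hq : q.natDegree ≤ m + 1) :
    ∃ A : ℝ, 0 < A ∧ ∀ M : ℝ, 1 ≤ M → ∀ y z : ℂ, ‖y‖ ≤ M → ‖z‖ ≤ M →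
      ‖q.eval z - q.eval y‖ ≤ A * M ^ m * ‖z - y‖ := by
  obtain ⟨A, hA, h⟩ := poly_bound q.derivative m
    ((Polynomial.natDegree_derivative_le q).trans (by omega))
  refine ⟨A, hA, fun M hM y z hy hz => ?_⟩
  refine Convex.norm_image_sub_le_of_norm_deriv_le (s := Metric.closedBall (0 : ℂ) M)
    (f := fun x => q.eval x) (fun x _ => q.differentiableAt) (fun x hx => ?_)
    (convex_closedBall _ _) (by simpa using hy) (by simpa using hz)
  rw [Polynomial.deriv]
  exact h M hM x (by simpa using hx)

lemma poly_lower (q : Polynomial ℂ) (m : ℕ) (hq : q.natDegree = m + 2) (C : ℝ) (hC : 0 < C) :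
    ∃ c R : ℝ, 0 < c ∧ 1 ≤ R ∧ ∀ y z : ℂ, R ≤ ‖y‖ → ‖z - y‖ ≤ C →
      c * ‖y‖ ^ (m + 1) * ‖z - y‖ ≤ ‖q.eval z - q.eval y‖ := by
  have hb : q.coeff (m + 2) ≠ 0 := by
    rw [← hq]; exact Polynomial.leadingCoeff_ne_zero.2 (by rintro rfl; simp at hq)
  have hdeg : q.derivative.natDegree ≤ m + 1 :=
    (Polynomial.natDegree_derivative_le q).trans (by omega)
  obtain ⟨A, hA, h⟩ := poly_lead q.derivative m hdeg
  obtain ⟨A2, hA2, h2⟩ := poly_lip q.derivative m hdeg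
  set b := q.derivative.coeff (m + 1) with hbdef
  have hb' : 0 < ‖b‖ := by
    rw [norm_pos_iff, hbdef, Polynomial.coeff_derivative]
    refine mul_ne_zero hb ?_
    exact_mod_cast Nat.succ_ne_zero (m + 1)
  refine ⟨‖b‖ / 2, max (max 1 C) (2 * (A + A2 * 2 ^ m * C) / ‖b‖), by positivity,
    (le_max_left _ _).trans (le_max_left _ _), fun y z hy hz => ?_⟩
  have hy1 : 1 ≤ ‖y‖ := ((le_max_left _ _).trans (le_max_left _ _)).trans hy
  have hyC : C ≤ ‖y‖ := ((le_max_right _ _).trans (le_max_left _ _)).trans hy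
  have hyB : 2 * (A + A2 * 2 ^ m * C) / ‖b‖ ≤ ‖y‖ := (le_max_right _ _).trans hy
  rw [div_le_iff₀ hb'] at hyB
  have lin : ‖(q.eval z - q.derivative.eval y * z) - (q.eval y - q.derivative.eval y * y)‖ ≤
      (A2 * (2 * ‖y‖) ^ m * C) * ‖z - y‖ := by
    refine Convex.norm_image_sub_le_of_norm_deriv_le (s := Metric.closedBall y C)
      (f := fun x => q.eval x - q.derivative.eval y * x)
      (fun x _ => q.differentiableAt.sub (differentiableAt_id.const_mul _)) (fun x hx => ?_)
      (convex_closedBall _ _) (by simp [hC.le]) (by simpa [dist_eq_norm] using hz)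
    have hd : deriv (fun x => q.eval x - q.derivative.eval y * x) x =
        q.derivative.eval x - q.derivative.eval y := by
      have := (q.hasDerivAt x).sub ((hasDerivAt_id x).const_mul (q.derivative.eval y))
      rw [mul_one] at this
      exact this.deriv
    rw [hd]
    have hx' : ‖x - y‖ ≤ C := by simpa [dist_eq_norm] using hx
    have hxn : ‖x‖ ≤ 2 * ‖y‖ := by
      have := norm_le_norm_add_norm_sub' x y
      linarith
    refine (h2 (2 * ‖y‖) (by linarith) y x (by linarith) hxn).trans ?_
    exact mul_le_mul_of_nonneg_left hx' (by positivity)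
  have e : (q.eval z - q.derivative.eval y * z) - (q.eval y - q.derivative.eval y * y) =
      (q.eval z - q.eval y) - q.derivative.eval y * (z - y) := by ring
  rw [e] at lin
  have low : ‖b‖ * ‖y‖ ^ (m + 1) - A * ‖y‖ ^ m ≤ ‖q.derivative.eval y‖ := by
    have := h y hy1
    have h3 := norm_sub_norm_le (b * y ^ (m + 1)) (q.derivative.eval y)
    rw [norm_sub_rev, norm_mul, norm_pow] at h3
    linarith
  have h4 := norm_sub_norm_le (q.derivative.eval y * (z - y)) (q.eval z - q.eval y)
  rw [norm_sub_rev (q.derivative.eval y * (z - y)), norm_mul] at h4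
  have h5 := mul_le_mul_of_nonneg_right low (norm_nonneg (z - y))
  have h6 : ‖b‖ / 2 * ‖y‖ ^ (m + 1) * ‖z - y‖ ≤
      (‖b‖ * ‖y‖ ^ (m + 1) - A * ‖y‖ ^ m) * ‖z - y‖ - (A2 * (2 * ‖y‖) ^ m * C) * ‖z - y‖ := by
    rw [← sub_mul]
    refine mul_le_mul_of_nonneg_right ?_ (norm_nonneg _)
    rw [mul_pow, pow_succ]
    have := mul_le_mul_of_nonneg_right hyB (pow_nonneg (norm_nonneg y) m)
    nlinarith
  linarith

/-- The data of a (generalised) Hénon map together with its forward Green function. -/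
structure Hen (d : ℕ) (a : ℂ) (p : Polynomial ℂ) (H Hinv : ℂ × ℂ → ℂ × ℂ)
    (G : ℂ × ℂ → ℝ) : Prop where
  hd : 2 ≤ d
  ha : a ≠ 0
  hpd : p.natDegree = d
  hH : ∀ z : ℂ × ℂ, H z = (z.2, p.eval z.2 - a * z.1)
  hHinv : ∀ z : ℂ × ℂ, Hinv z = ((p.eval z.1 - z.2) / a, z.1)
  cont : Continuous G
  nonneg : ∀ z, 0 ≤ G z
  lim : ∀ z : ℂ × ℂ,
      Tendsto (fun n : ℕ => Real.log (max ‖H^[n] z‖ 1) / (d : ℝ) ^ n) atTop (𝓝 (G z))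
  hK : ∀ z, G z = 0 ↔ Bornology.IsBounded (Set.range fun n : ℕ => H^[n] z)

section
variable {d : ℕ} {a : ℂ} {p : Polynomial ℂ} {H Hinv : ℂ × ℂ → ℂ × ℂ} {G : ℂ × ℂ → ℝ}

lemma Hen.left (h : Hen d a p H Hinv G) : Function.LeftInverse Hinv H := by
  intro z
  rw [h.hHinv, h.hH]
  have := h.ha
  ext <;> simp [this]

lemma Hen.right (h : Hen d a p H Hinv G) : Function.RightInverse Hinv H := by
  intro z
  rw [h.hH, h.hHinv]
  have := h.ha
  ext
  · simp
  · simp; field_simp; ring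

lemma Hen.diffH (h : Hen d a p H Hinv G) : Differentiable ℂ H := by
  have : H = fun z => (z.2, p.eval z.2 - a * z.1) := funext h.hH
  rw [this]
  exact differentiable_snd.prodMk
    ((p.differentiable.comp differentiable_snd).sub (differentiable_fst.const_mul a))

lemma Hen.diffHinv (h : Hen d a p H Hinv G) : Differentiable ℂ Hinv := by
  have : Hinv = fun z => ((p.eval z.1 - z.2) / a, z.1) := funext h.hHinv
  rw [this]
  refine Differentiable.prodMk ?_ differentiable_fst
  have h1 : Differentiable ℂ fun z : ℂ × ℂ => p.eval z.1 - z.2 :=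
    Differentiable.sub (p.differentiable.comp differentiable_fst) differentiable_snd
  simp only [div_eq_mul_inv]
  exact h1.mul_const _

lemma diff_iter {f : ℂ × ℂ → ℂ × ℂ} (hf : Differentiable ℂ f) (n : ℕ) :
    Differentiable ℂ (f^[n]) := by
  induction n with
  | zero => exact differentiable_id
  | succ n ih => exact ih.comp hf

lemma Hen.dpos (h : Hen d a p H Hinv G) : (1 : ℝ) < d := by
  have := h.hd
  exact_mod_cast this

lemma Hen.dge (h : Hen d a p H Hinv G) : (2 : ℝ) ≤ d := by
  exact_mod_cast h.hd

lemma Hen.G_H (h : Hen d a p H Hinv G) (z : ℂ × ℂ) : G (H z) = d * G z := by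
  have h1 := h.lim (H z)
  have h2 := ((h.lim z).comp (tendsto_add_atTop_nat 1)).const_mul (d : ℝ)
  refine tendsto_nhds_unique h1 (h2.congr fun n => ?_)
  have hd0 : (d : ℝ) ≠ 0 := by have := h.dpos; linarith
  simp only [Function.comp, Function.iterate_succ_apply]
  rw [pow_succ]
  field_simp

lemma Hen.G_iter (h : Hen d a p H Hinv G) (n : ℕ) (z : ℂ × ℂ) :
    G (H^[n] z) = d ^ n * G z := by
  induction n with
  | zero => simp
  | succ n ih => rw [Function.iterate_succ_apply', h.G_H, ih]; ring

lemma Hen.iter_left (h : Hen d a p H Hinv G) (n : ℕ) (z : ℂ × ℂ) :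
    Hinv^[n] (H^[n] z) = z := h.left.iterate n z

lemma Hen.iter_right (h : Hen d a p H Hinv G) (n : ℕ) (z : ℂ × ℂ) :
    H^[n] (Hinv^[n] z) = z := h.right.iterate n z

lemma Hen.G_inv_iter (h : Hen d a p H Hinv G) (n : ℕ) (z : ℂ × ℂ) :
    G (Hinv^[n] z) = G z / d ^ n := by
  have hd0 : (d : ℝ) ≠ 0 := by have := h.dpos; linarith
  have := h.G_iter n (Hinv^[n] z)
  rw [h.iter_right] at this
  rw [this]; field_simp

/-- Growth: `log⁺ ‖H z‖ ≤ d log⁺ ‖z‖ + C`. -/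
lemma Hen.growth (h : Hen d a p H Hinv G) : ∃ C : ℝ, 0 < C ∧ ∀ z : ℂ × ℂ,
    Real.log (max ‖H z‖ 1) ≤ d * Real.log (max ‖z‖ 1) + C := by
  obtain ⟨A, hA, hb⟩ := poly_bound p d h.hpd.le
  refine ⟨Real.log (A + ‖a‖ + 1) + 1, ?_, fun z => ?_⟩
  · have : 0 ≤ Real.log (A + ‖a‖ + 1) := Real.log_nonneg (by have := norm_nonneg a; linarith)
    linarith
  set M := max ‖z‖ 1 with hM
  have hM1 : 1 ≤ M := le_max_right _ _
  have hz : ‖z‖ ≤ M := le_max_left _ _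
  have hMd : M ≤ M ^ d := le_self_pow₀ hM1 (by have := h.hd; omega)
  have hM1d : 1 ≤ M ^ d := one_le_pow₀ hM1
  have ha0 := norm_nonneg a
  have h1 : ‖H z‖ ≤ (A + ‖a‖ + 1) * M ^ d := by
    rw [h.hH, Prod.norm_def]
    refine max_le ?_ ?_
    · have : ‖z.2‖ ≤ M := (norm_snd_le z).trans hz
      simp only
      nlinarith
    · have h2 := hb M hM1 z.2 ((norm_snd_le z).trans hz)
      have h3 : ‖a * z.1‖ ≤ ‖a‖ * M ^ d := by
        rw [norm_mul]
        exact mul_le_mul_of_nonneg_left (((norm_fst_le z).trans hz).trans hMd) ha0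
      have := norm_sub_le (p.eval z.2) (a * z.1)
      simp only
      nlinarith
  have h2 : max ‖H z‖ 1 ≤ (A + ‖a‖ + 1) * M ^ d := by
    refine max_le h1 ?_
    nlinarith
  have h3 := Real.log_le_log (by positivity) h2
  rw [Real.log_mul (by positivity) (by positivity), Real.log_pow] at h3
  linarith

lemma Hen.antitone_aux (h : Hen d a p H Hinv G) : ∃ C : ℝ, 0 < C ∧ ∀ z : ℂ × ℂ,
    Antitone (fun n : ℕ => Real.log (max ‖H^[n] z‖ 1) / (d : ℝ) ^ n + C / (d : ℝ) ^ n) := by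
  obtain ⟨C, hC, hg⟩ := h.growth
  refine ⟨C, hC, fun z => antitone_nat_of_succ_le fun n => ?_⟩
  have hd := h.dge
  have hdn : (0 : ℝ) < (d : ℝ) ^ n := by positivity
  rw [← add_div, ← add_div, pow_succ, div_le_div_iff₀ (by positivity) (by positivity),
    Function.iterate_succ_apply']
  have := hg (H^[n] z)
  have h2 : (Real.log (max ‖H (H^[n] z)‖ 1) + C) ≤ (Real.log (max ‖H^[n] z‖ 1) + C) * d := by
    nlinarith
  calc _ ≤ ((Real.log (max ‖H^[n] z‖ 1) + C) * d) * (d : ℝ) ^ n :=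
        mul_le_mul_of_nonneg_right h2 hdn.le
    _ = _ := by ring

lemma Hen.tendsto_aux (h : Hen d a p H Hinv G) (C : ℝ) (z : ℂ × ℂ) :
    Tendsto (fun n : ℕ => Real.log (max ‖H^[n] z‖ 1) / (d : ℝ) ^ n + C / (d : ℝ) ^ n) atTop
      (𝓝 (G z)) := by
  have h2 : Tendsto (fun n : ℕ => C / (d : ℝ) ^ n) atTop (𝓝 0) :=
    tendsto_const_nhds.div_atTop (tendsto_pow_atTop_atTop_of_one_lt h.dpos)
  simpa using (h.lim z).add h2

lemma Hen.G_le (h : Hen d a p H Hinv G) : ∃ C : ℝ, 0 < C ∧ ∀ z : ℂ × ℂ,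
    G z ≤ Real.log (max ‖z‖ 1) + C := by
  obtain ⟨C, hC, hg⟩ := h.antitone_aux
  refine ⟨C, hC, fun z => ?_⟩
  have := (hg z).le_of_tendsto (h.tendsto_aux C z) 0
  simpa using this

lemma Hen.ul (h : Hen d a p H Hinv G) : UL G univ := by
  intro Q _ hQ ε hε
  obtain ⟨C, hC, hg⟩ := h.antitone_aux
  have hcont : ∀ n, Continuous (H^[n]) := fun n => (diff_iter h.diffH n).continuous
  have hu := Antitone.tendstoUniformlyOn_of_forall_tendsto (s := Q)
    (F := fun (n : ℕ) z => Real.log (max ‖H^[n] z‖ 1) / (d : ℝ) ^ n + C / (d : ℝ) ^ n) (f := G) hQ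
    (fun n => by
      apply Continuous.continuousOn
      have h1 : Continuous fun z => max ‖H^[n] z‖ 1 := ((hcont n).norm).max continuous_const
      exact ((h1.log (fun z => (lt_of_lt_of_le one_pos (le_max_right _ _)).ne')).div_const
        _).add continuous_const)
    (fun z _ => hg z) h.cont.continuousOn (fun z _ => h.tendsto_aux C z)
  rw [Metric.tendstoUniformlyOn_iff] at hu
  have h2 : Tendsto (fun n : ℕ => C / (d : ℝ) ^ n) atTop (𝓝 0) :=
    tendsto_const_nhds.div_atTop (tendsto_pow_atTop_atTop_of_one_lt h.dpos)
  obtain ⟨n, hn1, hn2⟩ := ((hu (ε / 2) (by positivity)).and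
    (h2.eventually (gt_mem_nhds (show (0 : ℝ) < ε / 2 by positivity)))).exists
  have hd0 : (0 : ℝ) < d := by have := h.dpos; linarith
  refine ⟨1 / (d : ℝ) ^ n, fun z => (H^[n] z, 1), by positivity,
    ((diff_iter h.diffH n).prodMk (differentiable_const _)).differentiableOn, fun z => ?_,
    fun z hz => ?_⟩
  · rw [Prod.norm_def]; simp
  · have h3 := hn1 z hz
    rw [Real.dist_eq] at h3
    have h4 : 0 < C / (d : ℝ) ^ n := by positivity
    have e : ‖((H^[n] z, 1) : (ℂ × ℂ) × ℂ)‖ = max ‖H^[n] z‖ 1 := by rw [Prod.norm_def]; simp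
    rw [e, one_div, ← div_eq_inv_mul]
    rw [abs_lt] at h3
    rw [abs_le]
    constructor <;> linarith [h3.1, h3.2]
end
end

end HenonAux

namespace HenonAux

section

/-- The escape region. -/
def Vp (R : ℝ) : Set (ℂ × ℂ) := {z | R ≤ ‖z.2‖ ∧ ‖z.1‖ ≤ ‖z.2‖}

/-- `R`, `A` are good constants for the Hénon map `H` with leading coefficient `b`. -/
structure Good (d : ℕ) (b : ℂ) (H : ℂ × ℂ → ℂ × ℂ) (R A : ℝ) : Prop where
  R1 : 1 ≤ R
  Apos : 0 < A
  hb : b ≠ 0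
  fst : ∀ z, (H z).1 = z.2
  half : ∀ z ∈ Vp R, A / ‖z.2‖ ≤ 1 / 2
  eps : ∀ z ∈ Vp R, ‖(H z).2 / (b * z.2 ^ d) - 1‖ ≤ A / ‖z.2‖
  grow : ∀ z ∈ Vp R, 2 * ‖z.2‖ ≤ ‖(H z).2‖

lemma Good.mono {d : ℕ} {b : ℂ} {H : ℂ × ℂ → ℂ × ℂ} {R R' A : ℝ} (g : Good d b H R A)
    (hR : R ≤ R') : Good d b H R' A :=
  ⟨g.R1.trans hR, g.Apos, g.hb, g.fst, fun z hz => g.half z ⟨hR.trans hz.1, hz.2⟩,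
    fun z hz => g.eps z ⟨hR.trans hz.1, hz.2⟩, fun z hz => g.grow z ⟨hR.trans hz.1, hz.2⟩⟩

section
variable {d : ℕ} {a : ℂ} {p : Polynomial ℂ} {H Hinv : ℂ × ℂ → ℂ × ℂ} {G : ℂ × ℂ → ℝ}
variable {b : ℂ} {R A : ℝ}

lemma Hen.lead_ne (h : Hen d a p H Hinv G) : p.coeff d ≠ 0 := by
  have := h.hd
  have h2 := h.hpd
  rw [← h2]; exact Polynomial.leadingCoeff_ne_zero.2 (by rintro rfl; simp at h2; omega)

lemma Hen.good (h : Hen d a p H Hinv G) : ∃ R A : ℝ, Good d (p.coeff d) H R A := by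
  have hb := h.lead_ne
  obtain ⟨m, rfl⟩ : ∃ m, d = m + 2 := ⟨d - 2, by have := h.hd; omega⟩
  obtain ⟨A0, hA0, hl⟩ := poly_lead p (m + 1) h.hpd.le
  set b := p.coeff (m + 2) with hbd
  have hb' : 0 < ‖b‖ := norm_pos_iff.2 hb
  have ha0 := norm_nonneg a
  set A := (A0 + ‖a‖) / ‖b‖ with hA
  have hAp : 0 < A := by positivity
  refine ⟨max (max 1 (2 * A)) (4 / ‖b‖), A, (le_max_left _ _).trans (le_max_left _ _), hAp, hb,
    fun z => by rw [h.hH], ?_, ?_, ?_⟩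
  all_goals
    intro z hz
    obtain ⟨hz1, hz2⟩ := hz
    have hy1 : 1 ≤ ‖z.2‖ := ((le_max_left _ _).trans (le_max_left _ _)).trans hz1
    have hyA : 2 * A ≤ ‖z.2‖ := ((le_max_right _ _).trans (le_max_left _ _)).trans hz1
    have hyb : 4 / ‖b‖ ≤ ‖z.2‖ := (le_max_right _ _).trans hz1
    have hy0 : 0 < ‖z.2‖ := by linarith
  have half : ∀ y : ℝ, 0 < y → 2 * A ≤ y → A / y ≤ 1 / 2 := by
    intro y hy hy2
    rw [div_le_iff₀ hy]; linarith
  · exact half _ hy0 hyA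
  all_goals
    have hpw : ‖z.2‖ ≤ ‖z.2‖ ^ (m + 1) := le_self_pow₀ hy1 (by omega)
    have key : ‖(H z).2 - b * z.2 ^ (m + 2)‖ ≤ (A0 + ‖a‖) * ‖z.2‖ ^ (m + 1) := by
      rw [h.hH]
      simp only
      have e : p.eval z.2 - a * z.1 - b * z.2 ^ (m + 2) =
        (p.eval z.2 - b * z.2 ^ (m + 2)) - a * z.1 := by ring
      rw [e]
      refine (norm_sub_le _ _).trans ?_
      have h1 := hl z.2 hy1
      have h2 : ‖a * z.1‖ ≤ ‖a‖ * ‖z.2‖ ^ (m + 1) := by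
        rw [norm_mul]
        exact mul_le_mul_of_nonneg_left (hz2.trans hpw) ha0
      have h1' : ‖p.eval z.2 - b * z.2 ^ (m + 2)‖ ≤ A0 * ‖z.2‖ ^ (m + 1) := h1
      linarith
  · have hz0 : z.2 ≠ 0 := norm_pos_iff.1 hy0
    have hne : b * z.2 ^ (m + 2) ≠ 0 := mul_ne_zero hb (pow_ne_zero _ hz0)
    have e : (H z).2 / (b * z.2 ^ (m + 2)) - 1 =
      ((H z).2 - b * z.2 ^ (m + 2)) / (b * z.2 ^ (m + 2)) := by field_simp
    rw [e, norm_div, norm_mul, norm_pow, div_le_iff₀ (by positivity)]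
    refine key.trans (le_of_eq ?_)
    rw [hA, pow_succ ‖z.2‖ (m + 1)]
    field_simp
  · have h3 := norm_sub_norm_le (b * z.2 ^ (m + 2)) (H z).2
    rw [norm_sub_rev, norm_mul, norm_pow] at h3
    have e1 : A0 + ‖a‖ = A * ‖b‖ := by rw [hA]; field_simp
    rw [e1] at key
    rw [div_le_iff₀ hb'] at hyb
    have h4 : ‖b‖ * ‖z.2‖ ^ (m + 2) - A * ‖b‖ * ‖z.2‖ ^ (m + 1) =
        ‖b‖ * ‖z.2‖ ^ (m + 1) * (‖z.2‖ - A) := by ring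
    have h5 : ‖b‖ * ‖z.2‖ * (‖z.2‖ / 2) ≤ ‖b‖ * ‖z.2‖ ^ (m + 1) * (‖z.2‖ - A) := by
      apply mul_le_mul _ _ (by positivity) (by positivity)
      · exact mul_le_mul_of_nonneg_left hpw hb'.le
      · linarith
    nlinarith

lemma Good.step (g : Good d b H R A) {z : ℂ × ℂ} (hz : z ∈ Vp R) : H z ∈ Vp R := by
  have h1 := g.grow z hz
  have h2 : R ≤ ‖z.2‖ := hz.1
  have h3 := g.R1
  refine ⟨by linarith, ?_⟩
  rw [g.fst]; linarith

lemma Good.iter (g : Good d b H R A) {z : ℂ × ℂ} (hz : z ∈ Vp R) (n : ℕ) :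
    H^[n] z ∈ Vp R := by
  induction n with
  | zero => exact hz
  | succ n ih => rw [Function.iterate_succ_apply']; exact g.step ih

lemma Good.iter_grow (g : Good d b H R A) {z : ℂ × ℂ} (hz : z ∈ Vp R) (n : ℕ) :
    2 ^ n * ‖z.2‖ ≤ ‖(H^[n] z).2‖ := by
  induction n with
  | zero => simp
  | succ n ih =>
    rw [Function.iterate_succ_apply']
    have := g.grow _ (g.iter hz n)
    rw [pow_succ]; linarith

lemma Good.norm_eq {z : ℂ × ℂ} (hz : z ∈ Vp R) : ‖z‖ = ‖z.2‖ := by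
  rw [Prod.norm_def]; exact max_eq_right hz.2

lemma Good.iter_mono (g : Good d b H R A) {z : ℂ × ℂ} (hz : z ∈ Vp R) (n : ℕ) :
    ‖z.2‖ ≤ ‖(H^[n] z).2‖ := by
  refine le_trans ?_ (g.iter_grow hz n)
  exact le_mul_of_one_le_left (norm_nonneg _) (one_le_pow₀ (by norm_num))

/-- A point whose orbit is never in `Vp R` has bounded orbit. -/
lemma Good.bdd (g : Good d b H R A) {ρ : ℝ} (hρ : R ≤ ρ) {z : ℂ × ℂ} (hz : ‖z‖ ≤ ρ)
    (hn : ∀ n, H^[n] z ∉ Vp R) (n : ℕ) : ‖H^[n] z‖ ≤ ρ := by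
  induction n with
  | zero => exact hz
  | succ n ih =>
    have h1 : ‖(H^[n+1] z).1‖ ≤ ρ := by
      rw [Function.iterate_succ_apply', g.fst]
      exact (norm_snd_le _).trans ih
    have h2 := hn (n + 1)
    rw [Prod.norm_def]
    refine max_le h1 ?_
    by_contra h3
    push Not at h3
    exact h2 ⟨by linarith, by linarith⟩

lemma Hen.escape (h : Hen d a p H Hinv G) (g : Good d b H R A) {z : ℂ × ℂ} (hz : 0 < G z) :
    ∃ n, ∀ k, n ≤ k → H^[k] z ∈ Vp R := by
  have : ∃ n, H^[n] z ∈ Vp R := by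
    by_contra hcon
    push Not at hcon
    have := (h.hK z).2 (by
      rw [isBounded_iff_forall_norm_le]
      refine ⟨max ‖z‖ R, ?_⟩
      rintro _ ⟨n, rfl⟩
      exact g.bdd (le_max_right _ _) (le_max_left _ _) hcon n)
    linarith
  obtain ⟨n, hn⟩ := this
  refine ⟨n, fun k hk => ?_⟩
  obtain ⟨j, rfl⟩ := Nat.exists_eq_add_of_le hk
  rw [add_comm, Function.iterate_add_apply]
  exact g.iter hn j

/-- terms of the Böttcher series -/
def bterm (d : ℕ) (b : ℂ) (H : ℂ × ℂ → ℂ × ℂ) (n : ℕ) (z : ℂ × ℂ) : ℂ :=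
  (1 / (d : ℂ) ^ (n + 1)) * Complex.log ((H^[n+1] z).2 / (b * (H^[n] z).2 ^ d))

def bsum (d : ℕ) (b : ℂ) (H : ℂ × ℂ → ℂ × ℂ) (z : ℂ × ℂ) : ℂ := ∑' n, bterm d b H n z

/-- The Böttcher coordinate. -/
def bot (d : ℕ) (b : ℂ) (H : ℂ × ℂ → ℂ × ℂ) (z : ℂ × ℂ) : ℂ :=
  z.2 * Complex.exp (bsum d b H z)

lemma Good.eps' (g : Good d b H R A) {z : ℂ × ℂ} (hz : z ∈ Vp R) (n : ℕ) :
    ‖(H^[n+1] z).2 / (b * (H^[n] z).2 ^ d) - 1‖ ≤ A / ‖z.2‖ := by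
  have h1 := g.eps _ (g.iter hz n)
  rw [Function.iterate_succ_apply']
  refine h1.trans ?_
  have h2 := g.iter_mono hz n
  have h3 : R ≤ ‖z.2‖ := hz.1
  have h4 := g.R1
  exact div_le_div_of_nonneg_left g.Apos.le (by linarith) h2

lemma Good.bterm_le (g : Good d b H R A) (hd : 2 ≤ d) {z : ℂ × ℂ} (hz : z ∈ Vp R) (n : ℕ) :
    ‖bterm d b H n z‖ ≤ (3 / 4 * (A / ‖z.2‖)) * (1 / 2) ^ n := by
  have h1 := g.eps' hz n
  have h2 := g.half z hz
  have h3 := Complex.norm_log_one_add_half_le_self (h1.trans h2)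
  rw [add_sub_cancel] at h3
  rw [bterm, norm_mul]
  have h4 : ‖(1 / (d : ℂ) ^ (n + 1))‖ ≤ (1 / 2) ^ (n + 1) := by
    rw [norm_div, norm_one, norm_pow, Complex.norm_natCast, one_div_pow]
    apply one_div_le_one_div_of_le (by positivity)
    exact pow_le_pow_left₀ (by norm_num) (by exact_mod_cast hd) _
  calc _ ≤ (1 / 2) ^ (n + 1) * (3 / 2 * (A / ‖z.2‖)) :=
        mul_le_mul h4 (h3.trans (by linarith)) (norm_nonneg _) (by positivity)
    _ = _ := by rw [pow_succ]; ring

lemma Good.summable (g : Good d b H R A) (hd : 2 ≤ d) {z : ℂ × ℂ} (hz : z ∈ Vp R) :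
    Summable (fun n => bterm d b H n z) :=
  Summable.of_norm_bounded (g := fun n : ℕ => (3 / 4 * (A / ‖z.2‖)) * (1 / 2) ^ n)
    (summable_geometric_two.mul_left _) (g.bterm_le hd hz)

lemma Good.bsum_le (g : Good d b H R A) (hd : 2 ≤ d) {z : ℂ × ℂ} (hz : z ∈ Vp R) :
    ‖bsum d b H z‖ ≤ 3 / 2 * (A / ‖z.2‖) := by
  have := tsum_of_norm_bounded (hasSum_geometric_two.mul_left (3 / 4 * (A / ‖z.2‖)))
    (g.bterm_le hd hz)
  rw [bsum]
  linarith

lemma Good.bsum_le_one (g : Good d b H R A) (hd : 2 ≤ d) {z : ℂ × ℂ} (hz : z ∈ Vp R) :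
    ‖bsum d b H z‖ ≤ 1 := by
  have h1 := g.bsum_le hd hz
  have h2 := g.half z hz
  linarith

lemma Good.bot_sub (g : Good d b H R A) (hd : 2 ≤ d) {z : ℂ × ℂ} (hz : z ∈ Vp R) :
    ‖bot d b H z - z.2‖ ≤ 3 * A := by
  have h1 := g.bsum_le hd hz
  have h2 := Complex.norm_exp_sub_one_le (g.bsum_le_one hd hz)
  have e : bot d b H z - z.2 = z.2 * (Complex.exp (bsum d b H z) - 1) := by rw [bot]; ring
  have h3 : R ≤ ‖z.2‖ := hz.1
  have h4 := g.R1
  have hy0 : 0 < ‖z.2‖ := by linarith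
  rw [e, norm_mul]
  calc ‖z.2‖ * ‖Complex.exp (bsum d b H z) - 1‖ ≤ ‖z.2‖ * (2 * (3 / 2 * (A / ‖z.2‖))) :=
        mul_le_mul_of_nonneg_left (h2.trans (by linarith)) hy0.le
    _ = 3 * A := by field_simp

lemma Good.ne0 (g : Good d b H R A) {z : ℂ × ℂ} (hz : z ∈ Vp R) : z.2 ≠ 0 := by
  have h3 : R ≤ ‖z.2‖ := hz.1
  have h4 := g.R1
  exact norm_pos_iff.1 (by linarith)

lemma Good.bot_ne (g : Good d b H R A) {z : ℂ × ℂ} (hz : z ∈ Vp R) : bot d b H z ≠ 0 :=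
  mul_ne_zero (g.ne0 hz) (Complex.exp_ne_zero _)

lemma Good.bot_H (g : Good d b H R A) (hd : 2 ≤ d) {z : ℂ × ℂ} (hz : z ∈ Vp R) :
    bot d b H (H z) = b * bot d b H z ^ d := by
  have hd0 : (d : ℂ) ≠ 0 := by
    have : d ≠ 0 := by omega
    exact_mod_cast this
  have hs : bsum d b H z = (1 / (d : ℂ)) * Complex.log ((H z).2 / (b * z.2 ^ d)) +
      (1 / (d : ℂ)) * bsum d b H (H z) := by
    rw [bsum, (g.summable hd hz).tsum_eq_zero_add, bsum, ← tsum_mul_left]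
    congr 1
    · simp [bterm]
    · congr 1
      funext n
      simp only [bterm, Function.iterate_succ_apply]
      rw [pow_succ (d : ℂ) (n + 1)]
      field_simp
  have hy := g.ne0 hz
  have hy1 := g.ne0 (g.step hz)
  have hb := g.hb
  have hne : (H z).2 / (b * z.2 ^ d) ≠ 0 :=
    div_ne_zero hy1 (mul_ne_zero hb (pow_ne_zero _ hy))
  have e : (d : ℂ) * bsum d b H z = Complex.log ((H z).2 / (b * z.2 ^ d)) + bsum d b H (H z) := by
    rw [hs]; field_simp
  rw [bot, bot, mul_pow, ← Complex.exp_nat_mul, e, Complex.exp_add, Complex.exp_log hne]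
  field_simp

lemma Good.log_bot (g : Good d b H R A) (hd : 2 ≤ d) {z : ℂ × ℂ} (hz : z ∈ Vp R) :
    |Real.log ‖bot d b H z‖ - Real.log ‖z.2‖| ≤ 1 := by
  have hy := norm_ne_zero_iff.2 (g.ne0 hz)
  rw [bot, norm_mul, Complex.norm_exp, Real.log_mul hy (Real.exp_ne_zero _), Real.log_exp,
    add_sub_cancel_left]
  exact (Complex.abs_re_le_norm _).trans (g.bsum_le_one hd hz)

lemma Hen.G_bot (h : Hen d a p H Hinv G) (g : Good d b H R A) {z : ℂ × ℂ} (hz : z ∈ Vp R) :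
    G z = Real.log ‖bot d b H z‖ + Real.log ‖b‖ / (d - 1) := by
  set β := Real.log ‖b‖ / ((d : ℝ) - 1) with hβ
  have hd1 : (d : ℝ) - 1 ≠ 0 := by have := h.dpos; linarith
  have hd0 : (0 : ℝ) < d := by have := h.dpos; linarith
  have hb := g.hb
  have it : ∀ n, Real.log ‖bot d b H (H^[n] z)‖ + β = d ^ n * (Real.log ‖bot d b H z‖ + β) := by
    intro n
    induction n with
    | zero => simp
    | succ n ih =>
      rw [Function.iterate_succ_apply', g.bot_H h.hd (g.iter hz n), norm_mul, norm_pow,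
        Real.log_mul (norm_ne_zero_iff.2 hb)
          (pow_ne_zero _ (norm_ne_zero_iff.2 (g.bot_ne (g.iter hz n)))), Real.log_pow,
          pow_succ, mul_comm ((d : ℝ) ^ n) d, mul_assoc, ← ih, hβ]
      field_simp
      ring
  refine tendsto_nhds_unique (h.lim z) ?_
  have hlim0 : Tendsto (fun n : ℕ => (1 + |β|) / (d : ℝ) ^ n) atTop (𝓝 0) :=
    tendsto_const_nhds.div_atTop (tendsto_pow_atTop_atTop_of_one_lt h.dpos)
  rw [tendsto_iff_norm_sub_tendsto_zero]
  refine squeeze_zero (fun _ => norm_nonneg _) (fun n => ?_) hlim0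
  have hv := g.iter hz n
  have h1 : 1 ≤ ‖(H^[n] z).2‖ := g.R1.trans hv.1
  rw [Good.norm_eq hv, max_eq_left h1]
  have h2 := g.log_bot h.hd hv
  have hdn : (0 : ℝ) < (d : ℝ) ^ n := by positivity
  have e : Real.log ‖(H^[n] z).2‖ / (d : ℝ) ^ n - (Real.log ‖bot d b H z‖ + β) =
      (-(Real.log ‖bot d b H (H^[n] z)‖ - Real.log ‖(H^[n] z).2‖) - β) / (d : ℝ) ^ n := by
    rw [eq_div_iff hdn.ne', sub_mul, div_mul_cancel₀ _ hdn.ne']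
    have := it n
    linarith
  rw [e, norm_div, Real.norm_eq_abs, Real.norm_eq_abs, abs_of_pos hdn]
  refine div_le_div_of_nonneg_right ?_ hdn.le
  refine (abs_sub _ _).trans ?_
  rw [abs_neg]
  linarith

lemma Hen.G_log (h : Hen d a p H Hinv G) (g : Good d b H R A) : ∃ C : ℝ, 0 < C ∧
    ∀ z ∈ Vp R, |G z - Real.log ‖z.2‖| ≤ C := by
  refine ⟨1 + |Real.log ‖b‖ / (d - 1)|, by positivity, fun z hz => ?_⟩
  rw [h.G_bot g hz]
  have h2 := g.log_bot h.hd hz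
  have e : Real.log ‖bot d b H z‖ + Real.log ‖b‖ / (d - 1) - Real.log ‖z.2‖ =
    (Real.log ‖bot d b H z‖ - Real.log ‖z.2‖) + Real.log ‖b‖ / (d - 1) := by ring
  rw [e]
  exact (abs_add_le _ _).trans (by linarith)

lemma Hen.diff_bot (h : Hen d a p H Hinv G) (g : Good d b H R A) (x : ℂ) :
    DifferentiableOn ℂ (fun y => bot d b H (x, y)) {y | R < ‖y‖ ∧ ‖x‖ < ‖y‖} := by
  have hop : IsOpen {y : ℂ | R < ‖y‖ ∧ ‖x‖ < ‖y‖} :=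
    (isOpen_lt continuous_const continuous_norm).inter (isOpen_lt continuous_const continuous_norm)
  have hmem : ∀ y ∈ {y : ℂ | R < ‖y‖ ∧ ‖x‖ < ‖y‖}, (x, y) ∈ Vp R :=
    fun y hy => ⟨hy.1.le, hy.2.le⟩
  have hR := g.R1
  have hs : DifferentiableOn ℂ (fun y => ∑' n, bterm d b H n (x, y))
      {y : ℂ | R < ‖y‖ ∧ ‖x‖ < ‖y‖} := by
    refine Complex.differentiableOn_tsum_of_summable_norm
      (u := fun n : ℕ => (3 / 4 * A) * (1 / 2) ^ n) (summable_geometric_two.mul_left _)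
      (fun n => ?_) hop (fun n y hy => ?_)
    · intro y hy
      have hv := hmem y hy
      have hit : ∀ k, DifferentiableAt ℂ (fun y => (H^[k] (x, y)).2) y := by
        intro k
        have h1 : Differentiable ℂ fun y : ℂ => ((x, y) : ℂ × ℂ) :=
          (differentiable_const x).prodMk differentiable_id
        exact (differentiable_snd.comp ((diff_iter h.diffH k).comp h1)).differentiableAt
      have hne : b * (H^[n] (x, y)).2 ^ d ≠ 0 :=
        mul_ne_zero g.hb (pow_ne_zero _ (g.ne0 (g.iter hv n)))
      refine DifferentiableAt.differentiableWithinAt ?_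
      unfold bterm
      refine DifferentiableAt.const_mul ?_ _
      refine DifferentiableAt.clog ((hit (n+1)).div (((hit n).pow d).const_mul b) hne) ?_
      have h1 := (g.eps' hv n).trans (g.half _ hv)
      rw [Complex.mem_slitPlane_iff]
      left
      have h2 := (abs_le.1 ((Complex.abs_re_le_norm _).trans h1)).1
      rw [Complex.sub_re, Complex.one_re] at h2
      linarith
    · refine (g.bterm_le h.hd (hmem y hy) n).trans ?_
      have : A / ‖y‖ ≤ A := div_le_self g.Apos.le (by have := hy.1; linarith)
      refine mul_le_mul_of_nonneg_right ?_ (by positivity)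
      simpa using this
  exact differentiableOn_id.mul hs.cexp

end
end

end HenonAux

namespace HenonAux

section

/-- The class of functions: uniform limits of logs, continuous, bounded between `0` and `B`. -/
structure Cls (w : ℂ × ℂ → ℝ) (Ω : Set (ℂ × ℂ)) (B : ℝ) : Prop where
  ul : UL w Ω
  cont : ContinuousOn w Ω
  nonneg : ∀ z ∈ Ω, 0 ≤ w z
  le : ∀ z ∈ Ω, w z ≤ B

lemma Cls.comp {w : ℂ × ℂ → ℝ} {Ω Ω' : Set (ℂ × ℂ)} {B : ℝ} (h : Cls w Ω B) {Φ : ℂ × ℂ → ℂ × ℂ}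
    (hΦ : DifferentiableOn ℂ Φ Ω') (hm : MapsTo Φ Ω' Ω) : Cls (fun z => w (Φ z)) Ω' B :=
  ⟨h.ul.comp hΦ hm, h.cont.comp hΦ.continuousOn hm, fun _ hz => h.nonneg _ (hm hz),
    fun _ hz => h.le _ (hm hz)⟩

section leafaux

variable {a : ℂ} {p : Polynomial ℂ} {Y Y' : ℕ → ℂ} {R C0 c0 : ℝ} {m : ℕ}

lemma delta_aux (hY : ∀ j, Y (j+2) = p.eval (Y (j+1)) - a * Y j)
    (hY' : ∀ j, Y' (j+2) = p.eval (Y' (j+1)) - a * Y' j)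
    (hc0 : 0 < c0) (hR : ∀ j, R ≤ ‖Y (j+1)‖) (hR0 : 0 ≤ R)
    (hlow : ∀ j, c0 * ‖Y (j+1)‖ ^ (m + 1) * ‖Y' (j+1) - Y (j+1)‖ ≤
      ‖p.eval (Y' (j+1)) - p.eval (Y (j+1))‖)
    (hbig : 2 * (1 + ‖a‖) ≤ c0 * R ^ (m + 1))
    (hC0 : ∀ j, ‖Y' j - Y j‖ ≤ C0) :
    (∀ j, ‖Y' (j+1) - Y (j+1)‖ ≤ ‖Y' j - Y j‖) ∧
    (∀ j, c0 / 2 * ‖Y (j+1)‖ ^ (m+1) * ‖Y' (j+1) - Y (j+1)‖ ≤ ‖a‖ * ‖Y' j - Y j‖) := by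
  have hbig' : ∀ j, 2 * (1 + ‖a‖) ≤ c0 * ‖Y (j+1)‖ ^ (m + 1) := fun j =>
    hbig.trans (by gcongr; exact hR j)
  have ha := norm_nonneg a
  have key : ∀ j, c0 * ‖Y (j+1)‖ ^ (m + 1) * ‖Y' (j+1) - Y (j+1)‖ ≤
      ‖Y' (j+2) - Y (j+2)‖ + ‖a‖ * ‖Y' j - Y j‖ := by
    intro j
    refine (hlow j).trans ?_
    have : p.eval (Y' (j+1)) - p.eval (Y (j+1)) = (Y' (j+2) - Y (j+2)) + a * (Y' j - Y j) := by
      rw [hY, hY']; ring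
    rw [this, ← norm_mul]
    exact norm_add_le _ _
  have key2 : ∀ j, 2 * (1 + ‖a‖) * ‖Y' (j+1) - Y (j+1)‖ ≤
      ‖Y' (j+2) - Y (j+2)‖ + ‖a‖ * ‖Y' j - Y j‖ := fun j =>
    (mul_le_mul_of_nonneg_right (hbig' j) (norm_nonneg _)).trans (key j)
  have anti : ∀ j, ‖Y' (j+1) - Y (j+1)‖ ≤ ‖Y' j - Y j‖ := by
    intro j
    by_contra! hcon
    have grow : ∀ k, ‖Y' (j+k) - Y (j+k)‖ < ‖Y' (j+1+k) - Y (j+1+k)‖ ∧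
        2 ^ k * ‖Y' (j+1) - Y (j+1)‖ ≤ ‖Y' (j+1+k) - Y (j+1+k)‖ := by
      intro k
      induction k with
      | zero => simpa using hcon
      | succ k ih =>
        obtain ⟨h1, h2⟩ := ih
        have h3 := key2 (j+k)
        rw [show j + k + 1 = j+1+k by ring, show j + k + 2 = j+1+(k+1) by ring] at h3
        rw [show j + (k + 1) = j+1+k by ring]
        have h4 : ‖a‖ * ‖Y' (j+k) - Y (j+k)‖ ≤ ‖a‖ * ‖Y' (j+1+k) - Y (j+1+k)‖ := by gcongr
        have h5 : 2 * ‖Y' (j+1+k) - Y (j+1+k)‖ ≤ ‖Y' (j+1+(k+1)) - Y (j+1+(k+1))‖ := by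
          have : 0 ≤ ‖a‖ * ‖Y' (j+1+k) - Y (j+1+k)‖ := by positivity
          nlinarith
        have h6 : 0 < ‖Y' (j+1+k) - Y (j+1+k)‖ := lt_of_le_of_lt (norm_nonneg _) h1
        refine ⟨by linarith, ?_⟩
        rw [pow_succ]; linarith
    have hpos : 0 < ‖Y' (j+1) - Y (j+1)‖ := lt_of_le_of_lt (norm_nonneg _) hcon
    obtain ⟨k, hk⟩ := pow_unbounded_of_one_lt (C0 / ‖Y' (j+1) - Y (j+1)‖) (one_lt_two (α := ℝ))
    rw [div_lt_iff₀ hpos] at hk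
    linarith [(grow k).2, hC0 (j+1+k)]
  refine ⟨anti, fun j => ?_⟩
  have h1 := key j
  have h2 := anti (j+1)
  have h3 := hbig' j
  have h4 : 2 * ‖Y' (j+1) - Y (j+1)‖ ≤ c0 * ‖Y (j+1)‖ ^ (m + 1) * ‖Y' (j+1) - Y (j+1)‖ := by
    apply mul_le_mul_of_nonneg_right _ (norm_nonneg _); linarith
  have : c0 / 2 * ‖Y (j+1)‖ ^ (m+1) * ‖Y' (j+1) - Y (j+1)‖ =
    c0 * ‖Y (j+1)‖ ^ (m+1) * ‖Y' (j+1) - Y (j+1)‖ / 2 := by ring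
  rw [this]
  have : j + 1 + 1 = j + 2 := rfl
  rw [this] at h2
  linarith

lemma back_aux {Hinv : ℂ × ℂ → ℂ × ℂ} {C1 Λ : ℝ} (ha : a ≠ 0)
    (hHinv : ∀ z : ℂ × ℂ, Hinv z = ((p.eval z.1 - z.2) / a, z.1))
    (hY : ∀ j, Y (j+2) = p.eval (Y (j+1)) - a * Y j)
    (hc0 : 0 < c0) (hR : ∀ j, 1 ≤ ‖Y (j+1)‖)
    (anti : ∀ j, ‖Y' (j+1) - Y (j+1)‖ ≤ ‖Y' j - Y j‖)
    (hC0 : ∀ j, ‖Y' j - Y j‖ ≤ C0)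
    (hq : ∀ j, c0 / 2 * ‖Y (j+1)‖ ^ (m+1) * ‖Y' (j+1) - Y (j+1)‖ ≤ ‖a‖ * ‖Y' j - Y j‖)
    (hC1 : 0 < C1) (hlip : ∀ M : ℝ, 1 ≤ M → ∀ y z : ℂ, ‖y‖ ≤ M → ‖z‖ ≤ M →
      ‖p.eval z - p.eval y‖ ≤ C1 * M ^ (m+1) * ‖z - y‖)
    (hΛ1 : 1 ≤ Λ) (hΛ : C1 * 2 ^ (m+2) / c0 + 1 / ‖a‖ ≤ Λ) (N : ℕ) (ζ : ℂ)
    (hζ : ‖ζ‖ * Λ ^ N * C0 ≤ 1) (Q : ℂ × ℂ)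
    (hQ : Q = (Y N + ζ * (Y' N - Y N), Y (N+1) + ζ * (Y' (N+1) - Y (N+1)))) :
    ∀ k j, k + j = N → ‖(Hinv^[k] Q).1 - Y j‖ ≤ ‖ζ‖ * Λ ^ k * ‖Y' j - Y j‖ ∧
      ‖(Hinv^[k] Q).2 - Y (j+1)‖ ≤ ‖ζ‖ * Λ ^ k * ‖Y' (j+1) - Y (j+1)‖ := by
  intro k
  induction k with
  | zero =>
    intro j hj
    obtain rfl : j = N := by omega
    simp [hQ]
  | succ k ih =>
    intro j hj
    obtain ⟨h1, h2⟩ := ih (j+1) (by omega)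
    have hap : 0 < ‖a‖ := norm_pos_iff.2 ha
    rw [Function.iterate_succ_apply', hHinv]
    set q := Hinv^[k] Q
    have hmon : ‖ζ‖ * Λ ^ k ≤ ‖ζ‖ * Λ ^ (k+1) := by gcongr; omega
    have hmonN : ‖ζ‖ * Λ ^ k ≤ ‖ζ‖ * Λ ^ N := by gcongr; omega
    have he1 : ‖q.1 - Y (j+1)‖ ≤ 1 := by
      refine h1.trans (le_trans ?_ hζ)
      gcongr
      exact hC0 _
    refine ⟨?_, h1.trans (by gcongr)⟩
    have hq1 : ‖q.1‖ ≤ 2 * ‖Y (j+1)‖ := by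
      have := norm_le_norm_add_norm_sub' q.1 (Y (j+1))
      linarith [hR j]
    have hl := hlip (2 * ‖Y (j+1)‖) (by linarith [hR j]) (Y (j+1)) q.1
      (by linarith [norm_nonneg (Y (j+1))]) hq1
    have hid : (p.eval q.1 - q.2) / a - Y j =
        ((p.eval q.1 - p.eval (Y (j+1))) - (q.2 - Y (j+2))) / a := by
      rw [hY j]; field_simp; ring
    simp only []
    rw [hid, norm_div]
    rw [div_le_iff₀ hap]
    refine (norm_sub_le _ _).trans ?_
    have e1 : C1 * (2 * ‖Y (j+1)‖) ^ (m+1) * ‖q.1 - Y (j+1)‖ ≤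
       ‖ζ‖ * Λ ^ k * (C1 * 2 ^ (m+2) / c0) * (‖a‖ * ‖Y' j - Y j‖) := by
      calc C1 * (2 * ‖Y (j+1)‖) ^ (m+1) * ‖q.1 - Y (j+1)‖ 
          ≤ C1 * (2 * ‖Y (j+1)‖) ^ (m+1) * (‖ζ‖ * Λ ^ k * ‖Y' (j+1) - Y (j+1)‖) := by gcongr
        _ = ‖ζ‖ * Λ ^ k * (C1 * 2 ^ (m+2) / c0) * 
            (c0 / 2 * ‖Y (j+1)‖ ^ (m+1) * ‖Y' (j+1) - Y (j+1)‖) := by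
          rw [mul_pow]; field_simp; ring
        _ ≤ _ := mul_le_mul_of_nonneg_left (hq j) (by positivity)
    have e2 : ‖q.2 - Y (j+2)‖ ≤ ‖ζ‖ * Λ ^ k * (1 / ‖a‖) * (‖a‖ * ‖Y' j - Y j‖) := by
      calc ‖q.2 - Y (j+2)‖ ≤ ‖ζ‖ * Λ ^ k * ‖Y' (j+2) - Y (j+2)‖ := h2
        _ ≤ ‖ζ‖ * Λ ^ k * ‖Y' j - Y j‖ := by gcongr; exact (anti _).trans (anti _)
        _ = _ := by field_simp
    calc _ ≤ ‖ζ‖ * Λ ^ k * (C1 * 2 ^ (m+2) / c0) * (‖a‖ * ‖Y' j - Y j‖)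
            + ‖ζ‖ * Λ ^ k * (1 / ‖a‖) * (‖a‖ * ‖Y' j - Y j‖) := by linarith
      _ = ‖ζ‖ * Λ ^ k * (C1 * 2 ^ (m+2) / c0 + 1 / ‖a‖) * (‖a‖ * ‖Y' j - Y j‖) := by ring
      _ ≤ ‖ζ‖ * Λ ^ k * Λ * (‖a‖ * ‖Y' j - Y j‖) := by gcongr
      _ = _ := by rw [pow_succ]; ring

end leafaux

end

end HenonAux

namespace HenonAux

section

variable {d : ℕ} {a : ℂ} {p : Polynomial ℂ} {H Hinv : ℂ × ℂ → ℂ × ℂ} {G : ℂ × ℂ → ℝ}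

lemma Good.bot_iter {b : ℂ} {R A : ℝ} (g : Good d b H R A) (hd : 2 ≤ d) {z z' : ℂ × ℂ}
    (hz : z ∈ Vp R) (hz' : z' ∈ Vp R) (e : bot d b H z = bot d b H z') (n : ℕ) :
    bot d b H (H^[n] z) = bot d b H (H^[n] z') := by
  induction n with
  | zero => simpa using e
  | succ n ih =>
    rw [Function.iterate_succ_apply', Function.iterate_succ_apply', g.bot_H hd (g.iter hz n),
      g.bot_H hd (g.iter hz' n), ih]

lemma ratio_tendsto {D α β t C : ℝ} (hD : 1 < D) (ht : 0 < t) :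
    Tendsto (fun N : ℕ => (N * α + β) / (D ^ N * t - C)) atTop (𝓝 0) := by
  have h1 : Tendsto (fun N : ℕ => (N:ℝ) / D ^ N) atTop (𝓝 0) := by
    simpa using tendsto_pow_const_div_const_pow_of_one_lt 1 hD
  have h2 : Tendsto (fun N : ℕ => (1:ℝ) / D ^ N) atTop (𝓝 0) := by
    simpa using tendsto_pow_const_div_const_pow_of_one_lt 0 hD
  have h3 : Tendsto (fun N : ℕ => ((N:ℝ) / D ^ N * α + 1 / D ^ N * β) / (t - 1 / D ^ N * C))
      atTop (𝓝 ((0 * α + 0 * β) / (t - 0 * C))) := by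
    apply Tendsto.div
    · exact (h1.mul_const _).add (h2.mul_const _)
    · exact tendsto_const_nhds.sub (h2.mul_const _)
    · simpa using ht.ne'
  simp only [zero_mul, add_zero, zero_div] at h3
  refine h3.congr (fun N => ?_)
  have : D ^ N ≠ 0 := by positivity
  rw [← mul_div_mul_left _ (t - 1 / D ^ N * C) this]
  congr 1 <;> field_simp

lemma Hen.leaf (h : Hen d a p H Hinv G) : ∃ R A : ℝ, Good d (p.coeff d) H R A ∧
    ∀ (c B : ℝ) (w : ℂ × ℂ → ℝ), Cls w {z | G z < c} B → ∀ z ∈ Vp R, ∀ z' ∈ Vp R,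
      bot d (p.coeff d) H z = bot d (p.coeff d) H z' → 0 < G z → G z < c →
      w z' ≤ w z := by
  obtain ⟨R0, A, g0⟩ := h.good
  obtain ⟨m, hm⟩ : ∃ m, d = m + 2 := ⟨d - 2, by have := h.hd; omega⟩
  obtain ⟨C1, hC1, hlip⟩ := poly_lip p (m+1) (by rw [h.hpd, hm])
  obtain ⟨c0, R1, hc0, hR1, hlow⟩ := poly_lower p m (by rw [h.hpd, hm]) (6 * A)
    (by linarith [g0.Apos])
  set R := max (max R0 R1) (2 * (1 + ‖a‖) / c0) with hRdef
  have hRR0 : R0 ≤ R := (le_max_left _ _).trans (le_max_left _ _)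
  have hRR1 : R1 ≤ R := (le_max_right _ _).trans (le_max_left _ _)
  have hR1' : 1 ≤ R := hR1.trans hRR1
  have hRc : 2 * (1 + ‖a‖) ≤ c0 * R := by
    have : 2 * (1 + ‖a‖) / c0 ≤ R := le_max_right _ _
    rwa [div_le_iff₀' hc0] at this
  have g := g0.mono hRR0
  refine ⟨R, A, g, ?_⟩
  intro c B w hw z hz z' hz' hbot hG0 hGc
  have hbig : 2 * (1 + ‖a‖) ≤ c0 * R ^ (m+1) := hRc.trans (by
    gcongr; exact le_self_pow₀ hR1' (by omega))
  set b := p.coeff d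
  set t := G z with ht
  set Y : ℕ → ℂ := fun j => (H^[j] z).1 with hYdef
  set Y' : ℕ → ℂ := fun j => (H^[j] z').1 with hYdef'
  have hsnd : ∀ (x : ℂ × ℂ) j, (H^[j+1] x).1 = (H^[j] x).2 := fun x j => by
    rw [Function.iterate_succ_apply', g.fst]
  have hrec : ∀ (x : ℂ × ℂ) j, (H^[j+2] x).1 = p.eval (H^[j+1] x).1 - a * (H^[j] x).1 := by
    intro x j
    rw [hsnd x (j+1), Function.iterate_succ_apply', h.hH (H^[j] x)]
  have hYR : ∀ j, R ≤ ‖Y (j+1)‖ := by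
    intro j
    simp only [hYdef]; rw [hsnd]; exact (g.iter hz j).1
  have hΔS : ∀ j, ‖Y' (j+1) - Y (j+1)‖ ≤ 6 * A := by
    intro j
    simp only [hYdef, hYdef']
    rw [hsnd, hsnd]
    have e1 := g.bot_sub h.hd (g.iter hz j)
    have e2 := g.bot_sub h.hd (g.iter hz' j)
    rw [g.bot_iter h.hd hz hz' hbot j] at e1
    rw [norm_sub_rev] at e2
    have := norm_sub_le_norm_sub_add_norm_sub (H^[j] z').2 (bot d b H (H^[j] z')) (H^[j] z).2
    linarith
  set C0 := max (6 * A) ‖Y' 0 - Y 0‖ with hC0def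
  have hC0 : ∀ j, ‖Y' j - Y j‖ ≤ C0 := by
    intro j
    cases j with
    | zero => exact le_max_right _ _
    | succ j => exact (hΔS j).trans (le_max_left _ _)
  have hC0pos : 0 < C0 := lt_of_lt_of_le (by linarith [g.Apos]) (le_max_left (6*A) _)
  obtain ⟨anti, hq⟩ := delta_aux (Y := Y) (Y' := Y') (R := R) (C0 := C0) (c0 := c0) (m := m)
    (hrec z) (hrec z') hc0 hYR (by linarith)
    (fun j => hlow _ _ (hRR1.trans (hYR j)) (hΔS j)) hbig hC0
  set Λ := max 1 (C1 * 2 ^ (m+2) / c0 + 1 / ‖a‖) with hΛ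
  have hΛ1 : 1 ≤ Λ := le_max_left _ _
  have hback := fun N ζ hζ => back_aux (Y := Y) (Y' := Y') (Hinv := Hinv) (C0 := C0) h.ha h.hHinv
    (hrec z) hc0 (fun j => hR1'.trans (hYR j)) anti hC0 hq hC1 hlip hΛ1 (le_max_right _ _) N ζ hζ _ rfl
  set Q : ℕ → ℂ → ℂ × ℂ := fun N ζ => 
    (Y N + ζ * (Y' N - Y N), Y (N+1) + ζ * (Y' (N+1) - Y (N+1))) with hQ
  have hpt : ∀ (x : ℂ × ℂ) N, ((H^[N] x).1, (H^[N+1] x).1) = H^[N] x := by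
    intro x N; rw [hsnd]
  have hQ0 : ∀ N, Q N 0 = H^[N] z := by
    intro N; simp only [hQ, zero_mul, add_zero]; exact hpt z N
  have hQ1 : ∀ N, Q N 1 = H^[N] z' := by
    intro N; simp only [hQ, one_mul, add_sub_cancel]; exact hpt z' N
  have hback' : ∀ N ζ, ‖ζ‖ * Λ ^ N * C0 ≤ 1 → ‖Hinv^[N] (Q N ζ) - z‖ ≤ ‖ζ‖ * Λ ^ N * C0 := by
    intro N ζ hζ
    obtain ⟨e1, e2⟩ := hback N ζ hζ N 0 (by omega)
    rw [Prod.norm_def]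
    refine max_le ?_ ?_
    · exact e1.trans (by gcongr; exact hC0 _)
    · refine le_trans (le_of_eq ?_) (e2.trans (by gcongr; exact hC0 _))
      have hY10 : Y (0+1) = z.2 := hsnd z 0
      rw [hY10]; rfl
  obtain ⟨CG, hCG, hGle⟩ := h.G_le
  obtain ⟨CL, hCL, hGlog⟩ := h.G_log g
  have hYlog : ∀ N, |(d:ℝ)^N * t - Real.log ‖Y (N+1)‖| ≤ CL := by
    intro N
    have := hGlog _ (g.iter hz N)
    rw [h.G_iter] at this
    simpa only [hYdef, hsnd] using this
  have hnormQ : ∀ N ζ, ‖ζ‖ ≤ ‖Y (N+1)‖ → ‖Q N ζ‖ ≤ ‖Y (N+1)‖ * (1 + C0) := by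
    intro N ζ hζ
    have hle : ‖Y N‖ ≤ ‖Y (N+1)‖ := by
      have := (g.iter hz N).2
      simpa only [hYdef, hsnd] using this
    have aux : ∀ j, ‖Y j‖ ≤ ‖Y (N+1)‖ → ‖Y j + ζ * (Y' j - Y j)‖ ≤ ‖Y (N+1)‖ * (1 + C0) := by
      intro j hj
      refine (norm_add_le _ _).trans ?_
      rw [norm_mul, mul_add, mul_one]
      gcongr
      exact hC0 j
    rw [Prod.norm_def]
    exact max_le (aux N hle) (aux (N+1) le_rfl)
  have hdN : ∀ N : ℕ, 0 < (d:ℝ)^N := fun N => by have := h.dpos; positivity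
  have hGQ : ∀ N ζ, ‖ζ‖ ≤ ‖Y (N+1)‖ → 
      G (Hinv^[N] (Q N ζ)) ≤ t + (CL + Real.log (1 + C0) + CG) / d ^ N := by
    intro N ζ hζ
    rw [h.G_inv_iter, div_le_iff₀ (hdN N), add_mul, div_mul_cancel₀ _ (hdN N).ne']
    have hY1 : 1 ≤ ‖Y (N+1)‖ := hR1'.trans (hYR N)
    have e1 : Real.log (max ‖Q N ζ‖ 1) ≤ Real.log ‖Y (N+1)‖ + Real.log (1 + C0) := by
      rw [← Real.log_mul (by linarith) (by linarith)]
      apply Real.log_le_log (by positivity)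
      refine max_le (hnormQ N ζ hζ) ?_
      nlinarith
    have e2 := abs_le.1 (hYlog N)
    have := hGle (Q N ζ)
    linarith [e2.1]
  have hΩev : ∀ᶠ N : ℕ in atTop, t + (CL + Real.log (1 + C0) + CG) / d ^ N < c := by
    have : Tendsto (fun N : ℕ => t + (CL + Real.log (1 + C0) + CG) / (d:ℝ) ^ N) atTop (𝓝 (t + 0)) := by
      apply tendsto_const_nhds.add
      apply tendsto_const_nhds.div_atTop
      exact tendsto_pow_atTop_atTop_of_one_lt h.dpos
    rw [add_zero] at this
    exact this.eventually (gt_mem_nhds hGc)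
  have hdiff : ∀ N, Differentiable ℂ (fun ζ => Hinv^[N] (Q N ζ)) := by
    intro N
    apply (diff_iter h.diffHinv N).comp
    simp only [hQ]
    fun_prop
  have hΩo : IsOpen {z | G z < c} := isOpen_lt h.cont continuous_const
  refine le_of_forall_pos_le_add (fun ε hε => ?_)
  have hwc : ContinuousAt w z := hw.cont.continuousAt (hΩo.mem_nhds hGc)
  obtain ⟨δ0, hδ0, hδ0'⟩ := Metric.continuousAt_iff.1 hwc ε hε
  set δ := min (δ0 / 2) 1 with hδ
  have hδp : 0 < δ := lt_min (by linarith) one_pos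
  have hδ1 : δ ≤ 1 := min_le_right _ _
  have hδδ : δ < δ0 := lt_of_le_of_lt (min_le_left _ _) (by linarith)
  set r1 : ℕ → ℝ := fun N => δ / (Λ ^ N * (C0 + 1)) with hr1
  have hr1p : ∀ N, 0 < r1 N := fun N => by simp only [hr1]; positivity
  have hΛN : ∀ N, 1 ≤ Λ ^ N := fun N => one_le_pow₀ hΛ1
  have hr1lt : ∀ N, r1 N < 1 := by
    intro N
    simp only [hr1]
    rw [div_lt_one (by positivity)]
    nlinarith [hΛN N]
  set mm := w z + ε
  have hmain : ∀ᶠ N : ℕ in atTop, w z' ≤ mm + |B - mm| *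
      ((N * Real.log Λ + Real.log ((C0 + 1) / δ)) / ((d:ℝ)^N * t - CL)) := by
    have hev2 : ∀ᶠ N : ℕ in atTop, CL < (d:ℝ)^N * t :=
      ((tendsto_pow_atTop_atTop_of_one_lt h.dpos).atTop_mul_const hG0).eventually_gt_atTop CL
    filter_upwards [hΩev, hev2] with N hN hN2
    have hY1 : 1 ≤ ‖Y (N+1)‖ := hR1'.trans (hYR N)
    have h3 := hw.ul.threeC (hdiff N) (r1 := r1 N) (r3 := ‖Y (N+1)‖) (hr1p N)
      (lt_of_lt_of_le (hr1lt N) hY1) (m1 := mm) (m3 := B)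
      (fun ζ hζ => by
        rw [mem_closedBall_zero_iff] at hζ
        exact lt_of_le_of_lt (hGQ N ζ hζ) hN)
      (fun ζ hζ => by
        have e1 : ‖ζ‖ * Λ ^ N * C0 ≤ δ := by
          rw [hζ]; simp only [hr1]
          rw [div_mul_eq_mul_div, div_mul_eq_mul_div, div_le_iff₀ (by positivity)]
          have : 0 < δ * Λ ^ N := by positivity
          nlinarith
        have e2 := hback' N ζ (e1.trans hδ1)
        have e3 := hδ0' (x := Hinv^[N] (Q N ζ)) (by rw [dist_eq_norm]; linarith)
        rw [Real.dist_eq] at e3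
        linarith [(abs_lt.1 e3).2])
      (fun ζ hζ => hw.le _ (lt_of_le_of_lt (hGQ N ζ hζ.le) hN))
      (ζ := 1) (by rw [norm_one]; exact (hr1lt N).le) (by rw [norm_one]; exact hY1)
    rw [hQ1, h.iter_left, norm_one] at h3
    refine h3.trans ?_
    have hl1 : Real.log (1 / r1 N) = N * Real.log Λ + Real.log ((C0 + 1) / δ) := by
      have : 1 / r1 N = Λ ^ N * ((C0 + 1) / δ) := by simp only [hr1]; field_simp
      rw [this, Real.log_mul (by positivity) (by positivity), Real.log_pow]
    have hl0 : 0 ≤ Real.log (1 / r1 N) := by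
      apply Real.log_nonneg
      rw [le_div_iff₀ (hr1p N)]; linarith [hr1lt N]
    have hl2 : (d:ℝ)^N * t - CL ≤ Real.log (‖Y (N+1)‖ / r1 N) := by
      have e : ‖Y (N+1)‖ / r1 N = ‖Y (N+1)‖ * (1 / r1 N) := by ring
      have hne : 1 / r1 N ≠ 0 := by have := hr1p N; positivity
      rw [e, Real.log_mul (by linarith) hne]
      linarith [(abs_le.1 (hYlog N)).2]
    have hpos : 0 < (d:ℝ)^N * t - CL := by linarith
    rw [← hl1]
    have e1 : 0 ≤ Real.log (1 / r1 N) / Real.log (‖Y (N+1)‖ / r1 N) :=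
      div_nonneg hl0 (by linarith)
    have e2 : Real.log (1 / r1 N) / Real.log (‖Y (N+1)‖ / r1 N) ≤
        Real.log (1 / r1 N) / ((d:ℝ)^N * t - CL) := by gcongr
    have e3 := mul_le_mul_of_nonneg_right (le_abs_self (B - mm)) e1
    have e4 := mul_le_mul_of_nonneg_left e2 (abs_nonneg (B - mm))
    linarith
  have hlim : Tendsto (fun N : ℕ => mm + |B - mm| *
      ((N * Real.log Λ + Real.log ((C0 + 1) / δ)) / ((d:ℝ)^N * t - CL))) atTop
      (𝓝 (mm + |B - mm| * 0)) :=
    tendsto_const_nhds.add (tendsto_const_nhds.mul (ratio_tendsto h.dpos hG0))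
  have := ge_of_tendsto hlim hmain
  simpa using this

end

end HenonAux

namespace HenonAux

section

variable {d : ℕ} {a : ℂ} {p : Polynomial ℂ} {H Hinv : ℂ × ℂ → ℂ × ℂ} {G : ℂ × ℂ → ℝ}

lemma Hen.push (h : Hen d a p H Hinv G) {w : ℂ × ℂ → ℝ} {c B : ℝ} (hw : Cls w {z | G z < c} B)
    (n : ℕ) : Cls (fun z => w (Hinv^[n] z)) {z | G z < d ^ n * c} B := by
  refine hw.comp (diff_iter h.diffHinv n).differentiableOn ?_
  intro z hz
  have hd := h.dpos
  simp only [mem_ofPred_eq] at hz ⊢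
  rw [h.G_inv_iter, div_lt_iff₀' (by positivity)]
  exact hz

lemma Good.bot_pow {b : ℂ} {R A : ℝ} (g : Good d b H R A) (hd : 2 ≤ d) (n : ℕ) :
    ∃ e : ℂ, ∀ z ∈ Vp R, bot d b H (H^[n] z) = e * bot d b H z ^ (d ^ n) := by
  induction n with
  | zero => exact ⟨1, fun z _ => by simp⟩
  | succ n ih =>
    obtain ⟨e, he⟩ := ih
    refine ⟨b * e ^ d, fun z hz => ?_⟩
    rw [Function.iterate_succ_apply', g.bot_H hd (g.iter hz n), he z hz, mul_pow, ← pow_mul,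
      pow_succ]
    ring

lemma Good.open_bot {b : ℂ} {R A : ℝ} (h : Hen d a p H Hinv G) (g : Good d b H R A) (x y : ℂ)
    (h1 : R + (6 * A + 2) < ‖y‖) (h2 : ‖x‖ + (6 * A + 2) < ‖y‖) :
    𝓝 (bot d b H (x, y)) ≤ map (fun y => bot d b H (x, y)) (𝓝 y) := by
  have hA := g.Apos
  have hsub : Metric.ball y (6 * A + 2) ⊆ {y | R < ‖y‖ ∧ ‖x‖ < ‖y‖} := by
    intro u hu
    rw [mem_ball_iff_norm] at hu
    have := norm_sub_norm_le y u
    rw [norm_sub_rev] at this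
    exact ⟨by linarith, by linarith⟩
  have hdiff : DifferentiableOn ℂ (fun y => bot d b H (x, y)) (Metric.ball y (6 * A + 2)) :=
    (h.diff_bot g x).mono hsub
  have han := hdiff.analyticOnNhd Metric.isOpen_ball
  have hy : y ∈ Metric.ball y (6 * A + 2) := Metric.mem_ball_self (by linarith)
  rcases (han y hy).eventually_constant_or_nhds_le_map_nhds with hc | hc
  · exfalso
    have heq := han.eqOn_of_preconnected_of_eventuallyEq (analyticOnNhd_const (v := bot d b H (x, y)))
      (convex_ball y _).isPreconnected hy hc
    set u : ℂ := y + ((6 * A + 1 : ℝ) : ℂ) with hu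
    have hun : ‖u - y‖ = 6 * A + 1 := by
      rw [hu, add_sub_cancel_left, Complex.norm_real, Real.norm_of_nonneg (by linarith)]
    have hub : u ∈ Metric.ball y (6 * A + 2) := by
      rw [mem_ball_iff_norm, hun]; linarith
    have e := heq hub
    simp only at e
    have v1 : (x, u) ∈ Vp R := ⟨(hsub hub).1.le, (hsub hub).2.le⟩
    have v2 : (x, y) ∈ Vp R := ⟨(hsub hy).1.le, (hsub hy).2.le⟩
    have b1 := g.bot_sub h.hd v1
    have b2 := g.bot_sub h.hd v2
    rw [e] at b1
    simp only at b1 b2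
    rw [norm_sub_rev] at b1
    have := norm_sub_le_norm_sub_add_norm_sub u (bot d b H (x, y)) y
    linarith
  · exact hc

lemma roots_dense {d : ℕ} (hd : 2 ≤ d) {α β : ℂ} (hα : α ≠ 0) (hn : ‖α‖ = ‖β‖) {S : Set ℂ}
    (hS : S ∈ 𝓝 β) : ∃ (n : ℕ) (ω : ℂ), ω ^ (d ^ n) = 1 ∧ ω * α ∈ S := by
  set s : ℝ := (β / α).arg / (2 * Real.pi) + 1 with hs
  have hpi := Real.pi_pos
  have hs0 : 0 ≤ s := by
    have := Complex.neg_pi_lt_arg (β / α)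
    have h2 : -1 ≤ (β / α).arg / (2 * Real.pi) := by
      rw [le_div_iff₀ (by positivity)]; linarith
    linarith
  have hβ : Complex.exp (2 * Real.pi * Complex.I * (s : ℂ)) * α = β := by
    have h1 : ‖β / α‖ = 1 := by
      rw [norm_div, hn, div_self]; rw [← hn]; exact norm_ne_zero_iff.2 hα
    have h2 := Complex.norm_mul_exp_arg_mul_I (β / α)
    rw [h1] at h2
    have h3 : (2 * Real.pi * Complex.I * (s : ℂ)) =
        ((β / α).arg : ℂ) * Complex.I + 2 * Real.pi * Complex.I := by
      rw [hs]; push_cast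
      have : (Real.pi : ℂ) ≠ 0 := by exact_mod_cast hpi.ne'
      field_simp
    rw [h3, Complex.exp_add, Complex.exp_two_pi_mul_I, mul_one]
    have h4 : Complex.exp ((β / α).arg * Complex.I) = β / α := by simpa using h2
    rw [h4]; field_simp
  have hd1 : (1:ℝ) < d := by exact_mod_cast hd
  have hlim : Tendsto (fun n : ℕ => ((⌊s * (d:ℝ)^n⌋₊ : ℝ) / (d:ℝ)^n)) atTop (𝓝 s) :=
    (tendsto_nat_floor_mul_div_atTop hs0).comp (tendsto_pow_atTop_atTop_of_one_lt hd1)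
  have hcont : Continuous (fun u : ℝ => Complex.exp (2 * Real.pi * Complex.I * (u : ℂ)) * α) := by
    fun_prop
  have hlim2 := (hcont.tendsto s).comp hlim
  rw [hβ] at hlim2
  obtain ⟨n, hn⟩ := (hlim2.eventually hS).exists
  refine ⟨n, _, ?_, hn⟩
  rw [← Complex.exp_nat_mul, Complex.exp_eq_one_iff]
  refine ⟨(⌊s * (d:ℝ)^n⌋₊ : ℤ), ?_⟩
  have : (d:ℂ) ^ n ≠ 0 := by
    have : (d:ℂ) ≠ 0 := by exact_mod_cast (by omega : d ≠ 0)
    positivity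
  push_cast
  field_simp

lemma Hen.T1le (h : Hen d a p H Hinv G) {w : ℂ × ℂ → ℝ} {c B : ℝ} (hw : Cls w {z | G z < c} B)
    {z1 z2 : ℂ × ℂ} (he : G z1 = G z2) (h0 : 0 < G z1) (hc : G z1 < c) : w z2 ≤ w z1 := by
  obtain ⟨R, A, g, leaf⟩ := h.leaf
  set R' := R + 6 * A + 3 with hR'
  have hA := g.Apos
  have hR1 := g.R1
  have g' := g.mono (show R ≤ R' by linarith)
  obtain ⟨n1, hn1⟩ := h.escape g' h0
  obtain ⟨n2, hn2⟩ := h.escape g' (he ▸ h0)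
  set k := max n1 n2
  have hv1 := hn1 k (le_max_left _ _)
  have hv2 := hn2 k (le_max_right _ _)
  have hd := h.dpos
  have hdk : 0 < (d:ℝ)^(k+1) := by positivity
  have hw' := h.push hw (k+1)
  set w' := fun z => w (Hinv^[k+1] z) with hw'def
  set u1 := H^[k+1] z1 with hu1
  set u2 := H^[k+1] z2 with hu2
  have e1 : w z1 = w' u1 := by simp only [hw'def, hu1, h.iter_left]
  have e2 : w z2 = w' u2 := by simp only [hw'def, hu2, h.iter_left]
  have hG1 : G u1 = d^(k+1) * G z1 := h.G_iter _ _
  have hG2 : G u2 = d^(k+1) * G z1 := by rw [he]; exact h.G_iter _ _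
  have hsubR : Vp R' ⊆ Vp R := fun z hz => ⟨by linarith [hz.1], hz.2⟩
  have hu1V : u1 ∈ Vp R := by
    rw [hu1, Function.iterate_succ_apply']; exact hsubR (g'.step hv1)
  have hu2V : u2 ∈ Vp R := by
    rw [hu2, Function.iterate_succ_apply']; exact hsubR (g'.step hv2)
  have hgap : R + (6 * A + 2) < ‖u2.2‖ ∧ ‖u2.1‖ + (6 * A + 2) < ‖u2.2‖ := by
    have e3 : u2 = H (H^[k] z2) := Function.iterate_succ_apply' _ _ _
    have e4 : u2.1 = (H^[k] z2).2 := by rw [e3, g.fst]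
    have e5 := g'.grow _ hv2
    rw [← e3] at e5
    have e6 := hv2.1
    rw [e4]
    constructor <;> linarith
  rw [e1, e2]
  generalize u1 = v1, u2 = v2 at *
  refine le_of_forall_pos_le_add (fun ε hε => ?_)
  set c' := (d:ℝ)^(k+1) * c
  have hc' : G v2 < c' := by rw [hG2]; exact mul_lt_mul_of_pos_left hc hdk
  have hc1' : G v1 < c' := by rw [hG1]; exact mul_lt_mul_of_pos_left hc hdk
  have hop := Good.open_bot h g v2.1 v2.2 hgap.1 hgap.2
  have hΩo : IsOpen {z | G z < c'} := isOpen_lt h.cont continuous_const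
  have hcw : ContinuousAt w' v2 := hw'.cont.continuousAt (hΩo.mem_nhds hc')
  have hcy : ContinuousAt (fun y : ℂ => (v2.1, y)) v2.2 := by fun_prop
  have hev1 : ∀ᶠ y in 𝓝 v2.2, w' v2 - ε < w' (v2.1, y) :=
    (ContinuousAt.comp (g := w') (f := fun y : ℂ => (v2.1, y)) hcw hcy).eventually
      (lt_mem_nhds (by simpa using hε))
  have hev2 : ∀ᶠ y in 𝓝 v2.2, R < ‖y‖ ∧ ‖v2.1‖ < ‖y‖ := by
    have hn : ContinuousAt (fun y : ℂ => ‖y‖) v2.2 := by fun_prop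
    exact (hn.eventually (lt_mem_nhds (by linarith))).and
      (hn.eventually (lt_mem_nhds (by linarith)))
  have hmem := hop (image_mem_map (hev1.and hev2))
  have hbn : ‖bot d (p.coeff d) H v1‖ = ‖bot d (p.coeff d) H (v2.1, v2.2)‖ := by
    have q1 := h.G_bot g hu1V
    have q2 := h.G_bot g hu2V
    apply Real.log_injOn_pos (norm_pos_iff.2 (g.bot_ne hu1V)) (norm_pos_iff.2 (g.bot_ne hu2V))
    linarith
  obtain ⟨n, ω, hω, y, ⟨hy1, hy2⟩, hyω⟩ := roots_dense h.hd (g.bot_ne hu1V) hbn hmem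
  simp only at hyω
  have hyV : (v2.1, y) ∈ Vp R := ⟨hy2.1.le, hy2.2.le⟩
  have hbpow : bot d (p.coeff d) H (H^[n] v1) = bot d (p.coeff d) H (H^[n] (v2.1, y)) := by
    obtain ⟨e, he⟩ := g.bot_pow h.hd n
    rw [he _ hu1V, he _ hyV, hyω, mul_pow, hω, one_mul]
  have hdn : 0 < (d:ℝ)^n := by positivity
  have := leaf _ B _ (h.push hw' n) _ (g.iter hu1V n) _ (g.iter hyV n) hbpow
    (by rw [h.G_iter, hG1]; positivity) (by rw [h.G_iter]; gcongr)
  simp only [h.iter_left] at this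
  linarith

lemma Hen.T1 (h : Hen d a p H Hinv G) {w : ℂ × ℂ → ℝ} {c B : ℝ} (hw : Cls w {z | G z < c} B)
    {z1 z2 : ℂ × ℂ} (he : G z1 = G z2) (h0 : 0 < G z1) (hc : G z1 < c) : w z1 = w z2 :=
  le_antisymm (h.T1le hw he.symm (he ▸ h0) (he ▸ hc)) (h.T1le hw he h0 hc)

lemma Hen.T2 (h : Hen d a p H Hinv G) {w : ℂ × ℂ → ℝ} {c B : ℝ} (hw : Cls w {z | G z < c} B)
    {z z' : ℂ × ℂ} (he : G z ≤ G z') (h0 : 0 < G z') (hc : G z' < c) : w z ≤ w z' := by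
  rcases he.eq_or_lt with he | he
  · exact (h.T1 hw he (he ▸ h0) (he ▸ hc)).le
  obtain ⟨R, A, g⟩ := h.good
  obtain ⟨C, hC, hlog⟩ := h.G_log g
  have hcont : Continuous (fun y : ℂ => G (z.1, y)) := h.cont.comp (by fun_prop)
  refine hw.ul.maxP (g := fun y => (z.1, y)) (U := {y | G (z.1, y) < G z'}) (ζ := z.2) (by fun_prop) ?_ ?_ ?_ he
  · rw [isBounded_iff_forall_norm_le]
    refine ⟨max (max R ‖z.1‖) (Real.exp (G z' + C)), fun y hy => ?_⟩
    by_contra! hcon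
    rw [max_lt_iff, max_lt_iff] at hcon
    have h1 := hlog (z.1, y) ⟨hcon.1.1.le, hcon.1.2.le⟩
    have h2 : G z' + C < Real.log ‖y‖ := by
      rw [Real.lt_log_iff_exp_lt (lt_of_le_of_lt (Real.exp_pos _).le hcon.2)]; exact hcon.2
    have h3 := (abs_le.1 h1).1
    simp only [mem_ofPred_eq] at hy h3
    linarith
  · intro y hy
    have := closure_lt_subset_le hcont continuous_const hy
    exact lt_of_le_of_lt this hc
  · intro y hy
    have : G (z.1, y) = G z' := frontier_lt_subset_eq hcont continuous_const hy
    exact (h.T1 hw this (this ▸ h0) (this ▸ hc)).le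

lemma Hen.T3 (h : Hen d a p H Hinv G) {w : ℂ × ℂ → ℝ} {c B : ℝ} (hw : Cls w {z | G z < c} B)
    {z1 z2 z3 : ℂ × ℂ} (h0 : 0 < G z1) (h12 : G z1 < G z2) (h23 : G z2 < G z3) (hc : G z3 < c) :
    (G z3 - G z1) * w z2 ≤ (G z3 - G z2) * w z1 + (G z2 - G z1) * w z3 := by
  obtain ⟨R, A, g⟩ := h.good
  obtain ⟨C1, hC1, hlog⟩ := h.G_log g
  obtain ⟨C2, hC2, hGle⟩ := h.G_le
  set C := max C1 C2
  have hCp : 0 < C := lt_of_lt_of_le hC1 (le_max_left _ _)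
  have hd := h.dpos
  have hpow := tendsto_pow_atTop_atTop_of_one_lt hd
  set t1 := G z1
  set t2 := G z2
  set t3 := G z3
  have key : ∀ᶠ n : ℕ in atTop, w z2 ≤ w z1 + (w z3 - w z1) *
      (((t2 - t1) + 2 * C / (d:ℝ)^n) / (t3 - t1)) := by
    have ev1 : ∀ᶠ n : ℕ in atTop, C ≤ (d:ℝ)^n * t1 :=
      (hpow.atTop_mul_const h0).eventually_ge_atTop C
    have ev2 : ∀ᶠ n : ℕ in atTop, 2 * C ≤ (d:ℝ)^n * (t3 - t2) :=
      (hpow.atTop_mul_const (by linarith)).eventually_ge_atTop _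
    have ev3 : ∀ᶠ n : ℕ in atTop, Real.log R ≤ (d:ℝ)^n * t2 :=
      (hpow.atTop_mul_const (by linarith)).eventually_ge_atTop _
    filter_upwards [ev1, ev2, ev3] with n h1 h2 h3
    have hdn : 0 < (d:ℝ)^n := by positivity
    have h13' : (d:ℝ)^n * t1 < (d:ℝ)^n * t3 := by gcongr; linarith
    have h12' : (d:ℝ)^n * t1 < (d:ℝ)^n * t2 := by gcongr
    have hup : ∀ (t : ℝ) (ζ : ℂ), C ≤ (d:ℝ)^n * t → ‖ζ‖ ≤ Real.exp (d^n * t - C) →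
        G (Hinv^[n] (0, ζ)) ≤ t := by
      intro t ζ ht hζ
      rw [h.G_inv_iter, div_le_iff₀' hdn]
      have e1 := hGle (0, ζ)
      have e2 : Real.log (max ‖((0:ℂ), ζ)‖ 1) ≤ d^n * t - C := by
        rw [Real.log_le_iff_le_exp (by positivity)]
        refine max_le ?_ (Real.one_le_exp (by linarith))
        simpa [Prod.norm_def] using hζ
      linarith [le_max_right C1 C2]
    set ζt : ℂ := ((Real.exp (d^n * t2 + C) : ℝ) : ℂ) with hζt
    have hζtn : ‖ζt‖ = Real.exp (d^n * t2 + C) := by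
      rw [hζt, Complex.norm_real, Real.norm_of_nonneg (Real.exp_pos _).le]
    have hζtV : ((0:ℂ), ζt) ∈ Vp R := by
      refine ⟨?_, by simp⟩
      simp only [hζtn]
      rw [← Real.log_le_iff_le_exp (by linarith [g.R1])]
      linarith
    have hlow : t2 ≤ G (Hinv^[n] (0, ζt)) := by
      rw [h.G_inv_iter, le_div_iff₀' hdn]
      have e1 := (abs_le.1 (hlog _ hζtV)).1
      simp only [hζtn, Real.log_exp] at e1
      linarith [le_max_left C1 C2]
    have hζt3 : ‖ζt‖ ≤ Real.exp (d^n * t3 - C) := by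
      rw [hζtn, Real.exp_le_exp]; linarith
    have hζot : Real.exp (d^n * t1 - C) ≤ ‖ζt‖ := by
      rw [hζtn, Real.exp_le_exp]; linarith
    have hin3 : ∀ ζ : ℂ, ‖ζ‖ ≤ Real.exp (d^n * t3 - C) → G (Hinv^[n] (0, ζ)) ≤ t3 :=
      fun ζ hζ => hup t3 ζ (by linarith) hζ
    have h3c := hw.ul.threeC (g := fun ζ => Hinv^[n] (0, ζ))
      ((diff_iter h.diffHinv n).comp (by fun_prop))
      (r1 := Real.exp (d^n * t1 - C)) (r3 := Real.exp (d^n * t3 - C)) (Real.exp_pos _)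
      (by rw [Real.exp_lt_exp]; linarith)
      (fun ζ hζ => lt_of_le_of_lt (hin3 ζ (by simpa using hζ)) hc)
      (m1 := w z1) (m3 := w z3)
      (fun ζ hζ => h.T2 hw (hup t1 ζ h1 hζ.le) h0 (by linarith))
      (fun ζ hζ => h.T2 hw (hin3 ζ hζ.le) (by linarith) hc)
      hζot hζt3
    have hfin : w z2 ≤ w (Hinv^[n] (0, ζt)) :=
      h.T2 hw hlow (by linarith) (lt_of_le_of_lt (hin3 _ hζt3) hc)
    refine hfin.trans (h3c.trans (le_of_eq ?_))
    rw [hζtn, ← Real.exp_sub, ← Real.exp_sub, Real.log_exp, Real.log_exp]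
    have : t3 - t1 ≠ 0 := by linarith
    have e : d ^ n * t3 - C - (d ^ n * t1 - C) = (d:ℝ)^n * (t3 - t1) := by ring
    rw [e]
    congr 2
    field_simp
    ring
  have hlim : Tendsto (fun n : ℕ => w z1 + (w z3 - w z1) *
      (((t2 - t1) + 2 * C / (d:ℝ)^n) / (t3 - t1))) atTop
      (𝓝 (w z1 + (w z3 - w z1) * (((t2 - t1) + 0) / (t3 - t1)))) := by
    refine tendsto_const_nhds.add (tendsto_const_nhds.mul (Tendsto.div_const ?_ _))
    exact tendsto_const_nhds.add (tendsto_const_nhds.div_atTop hpow)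
  have hfin := ge_of_tendsto hlim key
  have h13 : 0 < t3 - t1 := by linarith
  rw [add_zero, mul_div_assoc', ← sub_le_iff_le_add', le_div_iff₀ h13] at hfin
  linarith

end

end HenonAux

namespace HenonAux

section

variable {d : ℕ} {a : ℂ} {p : Polynomial ℂ} {H Hinv : ℂ × ℂ → ℂ × ℂ} {G : ℂ × ℂ → ℝ}

lemma Hen.exists_pos (h : Hen d a p H Hinv G) : ∃ z, 0 < G z := by
  obtain ⟨R, A, g⟩ := h.good
  obtain ⟨C, hC, hlog⟩ := h.G_log g
  set y : ℂ := ((R + Real.exp (C + 1) : ℝ) : ℂ) with hy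
  have hR := g.R1
  have hyn : ‖y‖ = R + Real.exp (C + 1) := by
    rw [hy, Complex.norm_real, Real.norm_of_nonneg]
    have := Real.exp_pos (C+1); linarith
  have hyV : ((0:ℂ), y) ∈ Vp R := by
    refine ⟨?_, by simp⟩
    simp only [hyn]; linarith [Real.exp_pos (C+1)]
  have e1 := (abs_le.1 (hlog _ hyV)).1
  have e2 : C + 1 ≤ Real.log ‖y‖ := by
    rw [Real.le_log_iff_exp_le (by rw [hyn]; linarith [Real.exp_pos (C+1)]), hyn]
    linarith
  simp only at e1
  exact ⟨_, by linarith⟩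

lemma Hen.level (h : Hen d a p H Hinv G) {s : ℝ} (hs : 0 < s) : ∃ z, G z = s := by
  obtain ⟨v, hv⟩ := h.exists_pos
  have hpow := tendsto_pow_atTop_atTop_of_one_lt h.dpos
  obtain ⟨n, hn⟩ := ((hpow.atTop_mul_const hv).eventually_ge_atTop s).exists
  obtain ⟨m, hm⟩ := ((hpow.atTop_mul_const hs).eventually_ge_atTop (G v)).exists
  have h1 : s ≤ G (H^[n] v) := by rw [h.G_iter]; exact hn
  have h2 : G (Hinv^[m] v) ≤ s := by
    have := h.dpos
    rw [h.G_inv_iter, div_le_iff₀' (by positivity)]; exact hm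
  exact mem_range_of_exists_le_of_exists_ge h.cont ⟨_, h2⟩ ⟨_, h1⟩

lemma Hen.not_Vp (h : Hen d a p H Hinv G) {b : ℂ} {R A : ℝ} (g : Good d b H R A) {z : ℂ × ℂ}
    (hz : G z = 0) : z ∉ Vp R := by
  intro hV
  have hb := (h.hK z).1 hz
  obtain ⟨C, hC⟩ := isBounded_iff_forall_norm_le.1 hb
  obtain ⟨k, hk⟩ := pow_unbounded_of_one_lt C (one_lt_two (α := ℝ))
  have h1 := hC _ (mem_range_self k)
  have h2 := g.iter_grow hV k
  have h3 : ‖(H^[k] z).2‖ ≤ ‖H^[k] z‖ := norm_snd_le _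
  have h4 : 1 ≤ ‖z.2‖ := g.R1.trans hV.1
  have h5 : (2:ℝ)^k ≤ 2 ^ k * ‖z.2‖ := le_mul_of_one_le_right (by positivity) h4
  linarith

lemma Hen.trap (h : Hen d a p H Hinv G) {b : ℂ} {R A : ℝ} (g : Good d b H R A) {ρ : ℝ} (hρ : R ≤ ρ)
    {z : ℂ × ℂ} (hz : G z = 0) (hn : ‖z‖ ≤ ρ) : G (H z) = 0 ∧ ‖H z‖ ≤ ρ := by
  refine ⟨by rw [h.G_H, hz, mul_zero], ?_⟩
  have := g.bdd hρ hn (fun n => h.not_Vp g (by rw [h.G_iter, hz, mul_zero])) 1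
  simpa using this

lemma Hen.int_sub (h : Hen d a p H Hinv G) {Gm : ℂ × ℂ → ℝ} (hGm : Continuous Gm)
    (hKm : ∀ z, Gm z = 0 ↔ Bornology.IsBounded (Set.range fun n : ℕ => Hinv^[n] z))
    (hv : ∀ S : Set (ℂ × ℂ), IsCompact S → MeasureTheory.volume S ≤ MeasureTheory.volume (H '' S))
    {U : Set (ℂ × ℂ)} (hU : IsOpen U) (hUG : ∀ z ∈ U, G z = 0) : ∀ z ∈ U, Gm z = 0 := by
  intro z hz
  by_contra hne
  obtain ⟨R, A, g⟩ := h.good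
  set ρ := max R (‖z‖ + 1) with hρ
  set V := U ∩ {z | Gm z ≠ 0} ∩ Metric.ball 0 ρ with hV
  have hVo : IsOpen V := (hU.inter (isOpen_ne_fun hGm continuous_const)).inter Metric.isOpen_ball
  have hzV : z ∈ V := by
    refine ⟨⟨hz, hne⟩, ?_⟩
    rw [mem_ball_zero_iff]
    exact lt_of_lt_of_le (lt_add_one _) (le_max_right _ _)
  set W : Set (ℂ × ℂ) := {z | G z = 0} ∩ Metric.closedBall 0 ρ with hW
  have hWc : IsCompact W := (isCompact_closedBall 0 ρ).inter_left
    (isClosed_eq h.cont continuous_const)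
  have hHc : ∀ n, Continuous (H^[n]) := fun n => h.diffH.continuous.iterate n
  have hHW : ∀ n, H^[n] '' W ⊆ W := by
    intro n
    induction n with
    | zero => simp
    | succ n ih =>
      rw [Function.iterate_succ', image_comp]
      refine (image_mono ih).trans ?_
      rintro _ ⟨x, ⟨hx1, hx2⟩, rfl⟩
      rw [mem_closedBall_zero_iff] at hx2
      obtain ⟨e1, e2⟩ := h.trap g (le_max_left _ _) hx1 hx2
      exact ⟨e1, by rwa [mem_closedBall_zero_iff]⟩
  have hcomp : ∀ n, IsCompact (H^[n] '' W) := fun n => hWc.image (hHc n)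
  have hvol : ∀ n, MeasureTheory.volume W ≤ MeasureTheory.volume (H^[n] '' W) := by
    intro n
    induction n with
    | zero => simp
    | succ n ih =>
      rw [Function.iterate_succ', image_comp]
      exact ih.trans (hv _ (hcomp n))
  have hnull : ∀ n, MeasureTheory.volume (W \ H^[n] '' W) = 0 := by
    intro n
    rw [MeasureTheory.measure_sdiff (hHW n) (hcomp n).measurableSet.nullMeasurableSet
      (hcomp n).measure_lt_top.ne]
    exact tsub_eq_zero_of_le (hvol n)
  have hVsub : V ⊆ ⋃ n, W \ H^[n] '' W := by
    intro v hv
    have hvW : v ∈ W := ⟨hUG v hv.1.1, Metric.ball_subset_closedBall hv.2⟩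
    by_contra hcon
    simp only [mem_iUnion, Set.mem_sdiff, not_exists, not_and, not_not] at hcon
    apply hv.1.2
    rw [hKm]
    refine isBounded_iff_forall_norm_le.2 ⟨ρ, ?_⟩
    rintro _ ⟨n, rfl⟩
    obtain ⟨x, hx, hxv⟩ := hcon n hvW
    simp only
    rw [← hxv, h.iter_left]
    exact mem_closedBall_zero_iff.1 hx.2
  have hV0 : MeasureTheory.volume V = 0 :=
    MeasureTheory.measure_mono_null hVsub (MeasureTheory.measure_iUnion_null hnull)
  exact (hVo.measure_pos _ ⟨z, hzV⟩).ne' hV0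

lemma Hen.vol (h : Hen d a p H Hinv G) : ∃ κ : ENNReal, ∀ S : Set (ℂ × ℂ), IsCompact S →
    MeasureTheory.volume (H '' S) = κ * MeasureTheory.volume S := by
  set L : (ℂ × ℂ) →ₗ[ℝ] (ℂ × ℂ) :=
    { toFun := fun z => (z.2, - a * z.1)
      map_add' := fun x y => by ext <;> simp <;> ring
      map_smul' := fun r x => by ext <;> simp <;> ring } with hL
  refine ⟨ENNReal.ofReal |LinearMap.det L|, fun S hS => ?_⟩
  have hHaar : (MeasureTheory.volume : MeasureTheory.Measure (ℂ × ℂ)).IsAddHaarMeasure := by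
    rw [MeasureTheory.Measure.volume_eq_prod]; infer_instance
  rw [← MeasureTheory.Measure.addHaar_image_linearMap]
  have hpc : Continuous (fun x => p.eval x) := p.continuous
  have hmp : MeasureTheory.MeasurePreserving (fun z : ℂ × ℂ => (z.1, z.2 - p.eval z.1))
      MeasureTheory.volume MeasureTheory.volume := by
    refine MeasureTheory.MeasurePreserving.skew_product (f := id) (g := fun x y => y - p.eval x)
      (MeasureTheory.MeasurePreserving.id _) ?_ ?_
    · apply Continuous.measurable
      simp only [Function.uncurry_def]
      fun_prop
    · filter_upwards with x
      exact (MeasureTheory.measurePreserving_sub_right MeasureTheory.volume (p.eval x)).map_eq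
  have himg : H '' S = (fun z : ℂ × ℂ => (z.1, z.2 - p.eval z.1)) ⁻¹' (L '' S) := by
    ext z
    constructor
    · rintro ⟨x, hx, rfl⟩
      refine ⟨x, hx, ?_⟩
      rw [h.hH]
      simp [hL]
    · rintro ⟨x, hx, hxz⟩
      refine ⟨x, hx, ?_⟩
      simp only [hL, LinearMap.coe_mk, AddHom.coe_mk, Prod.mk.injEq] at hxz
      rw [h.hH]
      ext
      · exact hxz.1
      · simp only [hxz.1]
        linear_combination hxz.2
  rw [himg, hmp.measure_preimage]
  have : IsCompact (L '' S) := hS.image (LinearMap.continuous_of_finiteDimensional L)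
  exact this.measurableSet.nullMeasurableSet

/-- conjugation by the coordinate swap -/
def sw (f : ℂ × ℂ → ℂ × ℂ) : ℂ × ℂ → ℂ × ℂ := fun z => (f z.swap).swap

lemma sw_sw (f : ℂ × ℂ → ℂ × ℂ) : sw (sw f) = f := by
  funext z; simp [sw]

lemma sw_iter (f : ℂ × ℂ → ℂ × ℂ) (n : ℕ) : (sw f)^[n] = sw (f^[n]) := by
  induction n with
  | zero => funext z; simp [sw]
  | succ n ih => rw [Function.iterate_succ', ih, Function.iterate_succ']; funext z; simp [sw]

lemma norm_swap (z : ℂ × ℂ) : ‖z.swap‖ = ‖z‖ := by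
  simp [Prod.norm_def, max_comm]

lemma bdd_swap (f : ℕ → ℂ × ℂ) : Bornology.IsBounded (Set.range fun n => (f n).swap) ↔
    Bornology.IsBounded (Set.range f) := by
  simp only [isBounded_iff_forall_norm_le, forall_mem_range, norm_swap]

structure Pair (d : ℕ) (a : ℂ) (p : Polynomial ℂ) (H Hinv : ℂ × ℂ → ℂ × ℂ)
    (Gp Gm : ℂ × ℂ → ℝ) : Prop where
  plus : Hen d a p H Hinv Gp
  minus : Hen d a⁻¹ (Polynomial.C a⁻¹ * p) (sw Hinv) (sw H) (fun z => Gm z.swap)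

variable {Gp Gm : ℂ × ℂ → ℝ}

lemma Pair.symm (P : Pair d a p H Hinv Gp Gm) :
    Pair d a⁻¹ (Polynomial.C a⁻¹ * p) (sw Hinv) (sw H) (fun z => Gm z.swap)
      (fun z => Gp z.swap) := by
  refine ⟨P.minus, ?_⟩
  have h1 : Polynomial.C a⁻¹⁻¹ * (Polynomial.C a⁻¹ * p) = p := by
    rw [← mul_assoc, ← Polynomial.C_mul, inv_inv, mul_inv_cancel₀ P.plus.ha, Polynomial.C_1, one_mul]
  rw [h1, inv_inv, sw_sw, sw_sw]
  simpa using P.plus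

lemma Pair.mk' (h : Hen d a p H Hinv Gp) (hGmcont : Continuous Gm) (hGmnonneg : ∀ z, 0 ≤ Gm z)
    (hGmlim : ∀ z : ℂ × ℂ,
      Tendsto (fun n : ℕ => Real.log (max ‖Hinv^[n] z‖ 1) / (d : ℝ) ^ n) atTop
        (𝓝 (Gm z)))
    (hK : ∀ z, Gm z = 0 ↔ Bornology.IsBounded (Set.range fun n : ℕ => Hinv^[n] z)) :
    Pair d a p H Hinv Gp Gm := by
  have ha := h.ha
  refine ⟨h, ⟨h.hd, inv_ne_zero ha, ?_, ?_, ?_, hGmcont.comp continuous_swap,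
    fun z => hGmnonneg _, ?_, ?_⟩⟩
  · rw [Polynomial.natDegree_C_mul (inv_ne_zero ha), h.hpd]
  · intro z
    simp only [sw, h.hHinv]
    ext <;> simp
    field_simp
  · intro z
    simp only [sw, h.hH]
    ext <;> simp
    field_simp
  · intro z
    simp only [sw_iter, sw, norm_swap]
    exact hGmlim _
  · intro z
    rw [hK]
    simp only [sw_iter, sw]
    exact (bdd_swap _).symm

lemma Pair.Gm_inv (P : Pair d a p H Hinv Gp Gm) (n : ℕ) (z : ℂ × ℂ) :
    Gm (H^[n] z) = Gm z / d ^ n := by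
  have := P.minus.G_inv_iter n z.swap
  simpa [sw_iter, sw] using this

lemma Pair.hKm (P : Pair d a p H Hinv Gp Gm) (z : ℂ × ℂ) :
    Gm z = 0 ↔ Bornology.IsBounded (Set.range fun n : ℕ => Hinv^[n] z) := by
  have := P.minus.hK z.swap
  simp only [sw_iter, sw, Prod.swap_swap] at this
  rw [this]
  exact bdd_swap _

lemma Pair.contm (P : Pair d a p H Hinv Gp Gm) : Continuous Gm := by
  have := P.minus.cont.comp continuous_swap
  simpa [Function.comp_def] using this

lemma Pair.nonnegm (P : Pair d a p H Hinv Gp Gm) (z : ℂ × ℂ) : 0 ≤ Gm z := by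
  simpa using P.minus.nonneg z.swap

lemma Pair.levelm (P : Pair d a p H Hinv Gp Gm) {s : ℝ} (hs : 0 < s) : ∃ z, Gm z = s := by
  obtain ⟨z, hz⟩ := P.minus.level hs
  exact ⟨_, hz⟩

lemma Pair.ulm (P : Pair d a p H Hinv Gp Gm) : UL Gm univ := by
  have := P.minus.ul.comp (Φ := Prod.swap) (Ω' := univ)
    (by
      have : Differentiable ℂ (fun z : ℂ × ℂ => (z.2, z.1)) := by fun_prop
      exact this.differentiableOn) (mapsTo_univ _ _)
  simpa using this

lemma Pair.clsm {w : ℂ × ℂ → ℝ} {c B : ℝ} (hw : Cls w {z | Gm z < c} B) :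
    Cls (fun z => w z.swap) {z | Gm z.swap < c} B := by
  refine hw.comp ?_ (fun z hz => hz)
  have : Differentiable ℂ (fun z : ℂ × ℂ => (z.2, z.1)) := by fun_prop
  exact this.differentiableOn

lemma Pair.T2m (P : Pair d a p H Hinv Gp Gm) {w : ℂ × ℂ → ℝ} {c B : ℝ}
    (hw : Cls w {z | Gm z < c} B)
    {z z' : ℂ × ℂ} (he : Gm z ≤ Gm z') (h0 : 0 < Gm z') (hc : Gm z' < c) : w z ≤ w z' := by
  have := P.minus.T2 (Pair.clsm hw) (z := z.swap) (z' := z'.swap) (by simpa using he)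
    (by simpa using h0) (by simpa using hc)
  simpa using this

lemma Pair.T3m (P : Pair d a p H Hinv Gp Gm) {w : ℂ × ℂ → ℝ} {c B : ℝ}
    (hw : Cls w {z | Gm z < c} B)
    {z1 z2 z3 : ℂ × ℂ} (h0 : 0 < Gm z1) (h12 : Gm z1 < Gm z2) (h23 : Gm z2 < Gm z3)
    (hc : Gm z3 < c) :
    (Gm z3 - Gm z1) * w z2 ≤ (Gm z3 - Gm z2) * w z1 + (Gm z2 - Gm z1) * w z3 := by
  have := P.minus.T3 (Pair.clsm hw) (z1 := z1.swap) (z2 := z2.swap) (z3 := z3.swap)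
    (by simpa using h0) (by simpa using h12) (by simpa using h23) (by simpa using hc)
  simpa using this

lemma Pair.unbdd (P : Pair d a p H Hinv Gp Gm) {t : ℝ} (ht : 0 < t) :
    ¬ Bornology.IsBounded {z | Gm z ≤ t} := by
  intro hb
  obtain ⟨v, hv⟩ := P.plus.exists_pos
  have hpow := tendsto_pow_atTop_atTop_of_one_lt P.plus.dpos
  obtain ⟨m, hm⟩ := (((hpow.atTop_mul_const ht).eventually_ge_atTop (Gm v))).exists_forall_of_atTop
  have hd := P.plus.dpos
  have hin : ∀ n ≥ m, H^[n] v ∈ {z | Gm z ≤ t} := by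
    intro n hn
    change Gm (H^[n] v) ≤ t
    rw [P.Gm_inv, div_le_iff₀' (by positivity)]
    exact hm n hn
  have hfin : Bornology.IsBounded ((fun n => H^[n] v) '' (Iio m)) :=
    ((finite_Iio m).image _).isBounded
  have : Bornology.IsBounded (range fun n => H^[n] v) := by
    refine (hb.union hfin).subset ?_
    rintro _ ⟨n, rfl⟩
    by_cases hn : m ≤ n
    · exact Or.inl (hin n hn)
    · exact Or.inr ⟨n, by simpa using hn, rfl⟩
  rw [← P.plus.hK] at this
  linarith

lemma Pair.bddK (P : Pair d a p H Hinv Gp Gm) : ∃ ρ : ℝ, ∀ z, Gp z = 0 → Gm z = 0 → ‖z‖ ≤ ρ := by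
  obtain ⟨R, A, g⟩ := P.plus.good
  obtain ⟨R', A', g'⟩ := P.minus.good
  refine ⟨max R R', fun z h1 h2 => ?_⟩
  by_contra! hcon
  rw [max_lt_iff] at hcon
  rcases le_total ‖z.1‖ ‖z.2‖ with hl | hl
  · refine P.plus.not_Vp g h1 ⟨?_, hl⟩
    rw [Prod.norm_def, max_eq_right hl] at hcon
    exact hcon.1.le
  · refine P.minus.not_Vp (z := z.swap) g' (by simpa using h2) ⟨?_, hl⟩
    rw [Prod.norm_def, max_eq_left hl] at hcon
    exact hcon.2.le

lemma Pair.dich (P : Pair d a p H Hinv Gp Gm) :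
    (∀ U : Set (ℂ × ℂ), IsOpen U → (∀ z ∈ U, Gp z = 0) → ∀ z ∈ U, Gm z = 0) ∨
    (∀ U : Set (ℂ × ℂ), IsOpen U → (∀ z ∈ U, Gm z = 0) → ∀ z ∈ U, Gp z = 0) := by
  obtain ⟨κ, hκ⟩ := P.plus.vol
  rcases le_total 1 κ with h1 | h1
  · left
    intro U hU hUG
    refine P.plus.int_sub P.contm P.hKm (fun S hS => ?_) hU hUG
    rw [hκ S hS]
    exact le_mul_of_one_le_left (zero_le) h1
  · right
    intro U hU hUG z hz
    have hsvol : ∀ S : Set (ℂ × ℂ), IsCompact S →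
        MeasureTheory.volume (Prod.swap '' S) = MeasureTheory.volume S := by
      intro S hS
      rw [image_swap_eq_preimage_swap]
      exact MeasureTheory.Measure.measurePreserving_swap.measure_preimage
        hS.measurableSet.nullMeasurableSet
    have := P.minus.int_sub (Gm := fun z => Gp z.swap) P.symm.contm P.symm.hKm (fun S hS => ?_)
      (U := Prod.swap ⁻¹' U) (hU.preimage continuous_swap) (fun z hz => hUG _ hz) z.swap
      (by simpa using hz)
    · simpa using this
    · have e1 : sw Hinv '' S = Prod.swap '' (Hinv '' (Prod.swap '' S)) := by
        rw [image_image, image_image]; rfl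
      have c1 : IsCompact (Prod.swap '' S) := hS.image continuous_swap
      have c2 : IsCompact (Hinv '' (Prod.swap '' S)) := c1.image P.plus.diffHinv.continuous
      rw [e1, hsvol _ c2, ← hsvol S hS]
      have e2 : H '' (Hinv '' (Prod.swap '' S)) = Prod.swap '' S := by
        rw [image_image]
        simp only [P.plus.right _, image_id']
      rw [← e2, hκ _ c2, e2]
      exact mul_le_of_le_one_left (zero_le) h1

end

end HenonAux

namespace HenonAux

section

variable {d : ℕ} {a : ℂ} {p : Polynomial ℂ} {H Hinv : ℂ × ℂ → ℂ × ℂ} {Gp Gm : ℂ × ℂ → ℝ}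

/-- hypotheses on the biholomorphism -/
structure Bih (φ ψ : ℂ × ℂ → ℂ × ℂ) (Gp Gm : ℂ × ℂ → ℝ) (c c' : ℝ) : Prop where
  dφ : DifferentiableOn ℂ φ {z | Gp z < c}
  dψ : DifferentiableOn ℂ ψ {z | Gm z < c'}
  mφ : ∀ z, Gp z < c → Gm (φ z) < c'
  mψ : ∀ z, Gm z < c' → Gp (ψ z) < c
  ψφ : ∀ z, Gp z < c → ψ (φ z) = z
  φψ : ∀ z, Gm z < c' → φ (ψ z) = z

variable {φ ψ : ℂ × ℂ → ℂ × ℂ} {c c' : ℝ}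

lemma Bih.cls (b : Bih φ ψ Gp Gm c c') (P : Pair d a p H Hinv Gp Gm) :
    Cls (fun z => Gm (φ z)) {z | Gp z < c} c' :=
  ⟨P.ulm.comp b.dφ (mapsTo_univ _ _), P.contm.comp_continuousOn b.dφ.continuousOn,
    fun _ _ => P.nonnegm _, fun z hz => (b.mφ z hz).le⟩

lemma Bih.compactFalse (b : Bih φ ψ Gp Gm c c') (P : Pair d a p H Hinv Gp Gm) (hc : 0 < c)
    (hc' : 0 < c') {s ρ : ℝ} (hs : 0 < s)
    (h1 : ∀ z, Gp z < c → Gm (φ z) < s → Gp z = 0 ∧ ‖z‖ ≤ ρ) : False := by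
  set W : Set (ℂ × ℂ) := {z | Gp z = 0} ∩ Metric.closedBall 0 ρ with hW
  have hWc : IsCompact W := (isCompact_closedBall 0 ρ).inter_left
    (isClosed_eq P.plus.cont continuous_const)
  have hWΩ : W ⊆ {z | Gp z < c} := fun z hz => by
    have : Gp z = 0 := hz.1
    change Gp z < c
    rw [this]; exact hc
  have hb : Bornology.IsBounded (φ '' W) :=
    (hWc.image_of_continuousOn (b.dφ.continuousOn.mono hWΩ)).isBounded
  have hm : 0 < min s c' := lt_min hs hc'
  refine P.unbdd (t := min s c' / 2) (by linarith) (hb.subset ?_)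
  intro w hw
  have hw' : Gm w ≤ min s c' / 2 := hw
  have hwc : Gm w < c' := by linarith [min_le_right s c']
  have hws : Gm w < s := by linarith [min_le_left s c']
  obtain ⟨e1, e2⟩ := h1 (ψ w) (b.mψ w hwc) (by rwa [b.φψ w hwc])
  exact ⟨ψ w, ⟨e1, by rwa [mem_closedBall_zero_iff]⟩, b.φψ w hwc⟩

lemma Bih.ratio (P : Pair d a p H Hinv Gp Gm) {W : ℂ × ℂ → ℝ} {B : ℝ}
    (hW : Cls W {z | Gm z < c'} B) (h0 : ∀ ε > 0, ∃ w, 0 < Gm w ∧ Gm w < c' ∧ W w < ε)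
    {w1 w2 : ℂ × ℂ} (hw1 : 0 < Gm w1) (h12 : Gm w1 ≤ Gm w2) (hw2 : Gm w2 < c') :
    Gm w2 * W w1 ≤ Gm w1 * W w2 := by
  have hmono := P.T2m hW h12 (by linarith) hw2
  rcases h12.eq_or_lt with h12 | h12
  · rw [h12]; exact mul_le_mul_of_nonneg_left hmono (by linarith)
  have key : ∀ ε > 0, Gm w2 * W w1 - Gm w1 * W w2 ≤ Gm w2 * ε := by
    intro ε hε
    obtain ⟨w0, e1, e2, e3⟩ := h0 ε hε
    have hW2 : 0 ≤ W w2 := hW.nonneg _ hw2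
    rcases le_or_gt (Gm w1) (Gm w0) with hl | hl
    · have e4 := P.T2m hW hl e1 e2
      have e5 : Gm w2 * W w1 ≤ Gm w2 * ε := mul_le_mul_of_nonneg_left (by linarith) (by linarith)
      have e6 : 0 ≤ Gm w1 * W w2 := by positivity
      linarith
    · have e4 := P.T3m hW e1 hl h12 hw2
      have e5 : 0 ≤ Gm w0 * (W w2 - W w1) := mul_nonneg e1.le (by linarith)
      have e6 : (Gm w2 - Gm w1) * W w0 ≤ (Gm w2 - Gm w1) * ε :=
        mul_le_mul_of_nonneg_left e3.le (by linarith)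
      have e7 : 0 ≤ Gm w1 * ε := by positivity
      linarith
  by_contra! hcon
  have hpos : 0 < Gm w2 := by linarith
  have := key ((Gm w2 * W w1 - Gm w1 * W w2) / (2 * Gm w2)) (div_pos (by linarith) (by linarith))
  have e : Gm w2 * ((Gm w2 * W w1 - Gm w1 * W w2) / (2 * Gm w2)) =
    (Gm w2 * W w1 - Gm w1 * W w2) / 2 := by field_simp
  rw [e] at this
  linarith

lemma Bih.claim (b : Bih φ ψ Gp Gm c c') (P : Pair d a p H Hinv Gp Gm) (hc : 0 < c)
    {z0 : ℂ × ℂ} (hz0 : Gp z0 = 0) (hL0 : 0 < Gm (φ z0)) :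
    ∃ s > 0, s ≤ Gm (φ z0) ∧ ∀ z, Gp z < c → Gm (φ z) < s → Gm (φ (H z)) = 0 := by
  by_contra! hcon
  set u := fun z => Gm (φ z) with hu
  have hcls := b.cls P
  set L0 := Gm (φ z0) with hL0def
  have hlow : ∀ z, 0 < Gp z → Gp z < c → L0 ≤ u z := fun z h1 h2 =>
    P.plus.T2 hcls (z := z0) (by rw [hz0]; exact h1.le) h1 h2
  have hd := P.plus.dpos
  have hGHinv : ∀ z, Gp (Hinv z) = Gp z / d := by
    intro z; simpa using P.plus.G_inv_iter 1 z
  have hGle : ∀ z, Gp (Hinv z) ≤ Gp z := fun z => by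
    rw [hGHinv]; exact div_le_self (P.plus.nonneg z) hd.le
  set W := fun w => u (Hinv (ψ w)) with hWdef
  have hW : Cls W {z | Gm z < c'} c' := by
    refine hcls.comp (Φ := fun w => Hinv (ψ w)) ?_ ?_
    · exact P.plus.diffHinv.comp_differentiableOn b.dψ
    · intro w hw
      exact lt_of_le_of_lt (hGle _) (b.mψ w hw)
  have hWφ : ∀ z, Gp z < c → W (φ z) = u (Hinv z) := fun z hz => by
    simp only [hWdef]; rw [b.ψφ z hz]
  have h0 : ∀ ε > 0, ∃ w, 0 < Gm w ∧ Gm w < c' ∧ W w < ε := by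
    intro ε hε
    obtain ⟨z, h1, h2, h3⟩ := hcon (min ε L0) (lt_min hε hL0) (min_le_right _ _)
    have hz : Gp z = 0 := by
      by_contra hne
      have := hlow z (lt_of_le_of_ne (P.plus.nonneg z) (Ne.symm hne)) h1
      have := min_le_right ε L0
      simp only [hu] at *
      linarith
    have hHz : Gp (H z) < c := by rw [P.plus.G_H, hz, mul_zero]; exact hc
    refine ⟨φ (H z), lt_of_le_of_ne (P.nonnegm _) (Ne.symm h3), b.mφ _ hHz, ?_⟩
    rw [hWφ _ hHz, P.plus.left]
    exact lt_of_lt_of_le h2 (min_le_left _ _)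
  have hinv : ∀ z, 0 < Gp z → Gp z < c → u (Hinv z) = u z := by
    intro z hz1 hz2
    set x : ℕ → ℝ := fun n => u (Hinv^[n] z) with hx
    have hGn : ∀ n, 0 < Gp (Hinv^[n] z) ∧ Gp (Hinv^[n] z) ≤ Gp z := by
      intro n
      rw [P.plus.G_inv_iter]
      exact ⟨by positivity, div_le_self hz1.le (one_le_pow₀ hd.le)⟩
    have hxL : ∀ n, L0 ≤ x n := fun n => hlow _ (hGn n).1 (lt_of_le_of_lt (hGn n).2 hz2)
    have hx0 : ∀ n, x n ≤ x 0 := fun n => P.plus.T2 hcls (hGn n).2 hz1 hz2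
    have hrat : ∀ n, x 0 * x (n+1) ≤ x n * x 1 := by
      intro n
      have hn2 := lt_of_le_of_lt (hGn n).2 hz2
      have := Bih.ratio P hW h0 (w1 := φ (Hinv^[n] z)) (w2 := φ z) (lt_of_lt_of_le hL0 (hxL n))
        (hx0 n) (b.mφ z hz2)
      rw [hWφ _ hn2, hWφ _ hz2, ← Function.iterate_succ_apply' Hinv] at this
      exact this
    have hx0p : 0 < x 0 := lt_of_lt_of_le hL0 (hxL 0)
    set r := x 1 / x 0 with hr
    have hr0 : 0 ≤ r := div_nonneg (hL0.le.trans (hxL 1)) hx0p.le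
    have hgeo : ∀ n, x n ≤ r ^ n * x 0 := by
      intro n
      induction n with
      | zero => simp
      | succ n ih =>
        have e1 : x (n+1) ≤ r * x n := by
          rw [hr, div_mul_eq_mul_div, le_div_iff₀ hx0p]
          linarith [hrat n]
        calc x (n+1) ≤ r * x n := e1
          _ ≤ r * (r ^ n * x 0) := by gcongr
          _ = _ := by ring
    have hr1 : 1 ≤ r := by
      by_contra! hlt
      have hl := (tendsto_pow_atTop_nhds_zero_of_lt_one hr0 hlt).mul_const (x 0)
      rw [zero_mul] at hl
      have := ge_of_tendsto' hl (fun n => (hxL n).trans (hgeo n))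
      linarith
    rw [hr, le_div_iff₀ hx0p, one_mul] at hr1
    exact le_antisymm (hx0 1) hr1
  have hinvn : ∀ n z, 0 < Gp z → Gp z < c → u (Hinv^[n] z) = u z := by
    intro n
    induction n with
    | zero => intro z _ _; rfl
    | succ n ih =>
      intro z h1 h2
      rw [Function.iterate_succ_apply, ih (Hinv z) (by rw [hGHinv]; positivity)
        (lt_of_le_of_lt (hGle z) h2), hinv z h1 h2]
  have hconst : ∀ z z', Gp z < c → 0 < Gp z' → Gp z' < c → u z ≤ u z' := by
    intro z z' h2 h1' h2'
    rcases (P.plus.nonneg z).eq_or_lt with h1 | h1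
    · exact P.plus.T2 hcls (by linarith) h1' h2'
    · have hpow := tendsto_pow_atTop_atTop_of_one_lt hd
      obtain ⟨n, hn⟩ := ((hpow.atTop_mul_const h1').eventually_ge_atTop (Gp z)).exists
      rw [← hinvn n z h1 h2]
      refine P.plus.T2 hcls ?_ h1' h2'
      rw [P.plus.G_inv_iter, div_le_iff₀' (by positivity)]
      exact hn
  obtain ⟨zs, hzs⟩ := P.plus.level (half_pos hc)
  have hzc : Gp zs < c := by linarith
  have hLc := b.mφ zs hzc
  have hn := P.nonnegm (φ zs)
  obtain ⟨w, hw⟩ := P.levelm (s := (Gm (φ zs) + c') / 2) (by linarith)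
  have hwc : Gm w < c' := by linarith
  have := hconst (ψ w) zs (b.mψ w hwc) (by linarith) hzc
  simp only [hu] at this
  rw [b.φψ w hwc] at this
  linarith

lemma Bih.main (b : Bih φ ψ Gp Gm c c') (P : Pair d a p H Hinv Gp Gm) (hc : 0 < c) (hc' : 0 < c')
    {z0 : ℂ × ℂ} (hz0 : Gp z0 = 0) : Gm (φ z0) = 0 := by
  by_contra hne
  have hL0 : 0 < Gm (φ z0) := lt_of_le_of_ne (P.nonnegm _) (Ne.symm hne)
  have hcls := b.cls P
  have hK : ∀ z, Gp z < c → Gm (φ z) < Gm (φ z0) → Gp z = 0 := by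
    intro z h1 h2
    by_contra hne
    have h3 : 0 < Gp z := lt_of_le_of_ne (P.plus.nonneg z) (Ne.symm hne)
    have := P.plus.T2 hcls (z := z0) (by rw [hz0]; exact h3.le) h3 h1
    linarith
  have hopen : ∀ s, IsOpen {z | Gp z < c ∧ Gm (φ z) < s} := fun s =>
    hcls.cont.isOpen_inter_preimage (isOpen_lt P.plus.cont continuous_const) isOpen_Iio
  obtain ⟨ρ, hρ⟩ := P.bddK
  rcases P.dich with hdi | hdi
  · refine b.compactFalse P hc hc' hL0 (ρ := ρ) (fun z h1 h2 => ⟨hK z h1 h2, ?_⟩)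
    exact hρ z (hK z h1 h2) (hdi _ (hopen _) (fun z hz => hK z hz.1 hz.2) z ⟨h1, h2⟩)
  · obtain ⟨s, hs, hsL, hcl⟩ := b.claim P hc hz0 hL0
    set V := {w | Gm w < c' ∧ Hinv (ψ w) ∈ {z | Gp z < c ∧ Gm (φ z) < s}} with hV
    have hVo : IsOpen V :=
      ((P.plus.diffHinv.comp_differentiableOn b.dψ).continuousOn).isOpen_inter_preimage
        (isOpen_lt P.contm continuous_const) (hopen s)
    have hV0 : ∀ w ∈ V, Gm w = 0 := by
      rintro w ⟨h1, h2, h3⟩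
      have := hcl _ h2 h3
      rwa [P.plus.right, b.φψ w h1] at this
    have hV1 := hdi V hVo hV0
    set KK : Set (ℂ × ℂ) := ({z | Gp z = 0} ∩ {z | Gm z = 0}) ∩ Metric.closedBall 0 ρ with hKK
    have hKKc : IsCompact KK := (isCompact_closedBall 0 ρ).inter_left
      ((isClosed_eq P.plus.cont continuous_const).inter (isClosed_eq P.contm continuous_const))
    have hKKΩ : KK ⊆ {z | Gm z < c'} := fun z hz => by
      have : Gm z = 0 := hz.1.2
      change Gm z < c'
      rw [this]; exact hc'
    have hb : Bornology.IsBounded ((fun w => Hinv (ψ w)) '' KK) :=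
      (hKKc.image_of_continuousOn
        (((P.plus.diffHinv.comp_differentiableOn b.dψ).continuousOn).mono hKKΩ)).isBounded
    obtain ⟨ρ', hρ'⟩ := isBounded_iff_forall_norm_le.1 hb
    refine b.compactFalse P hc hc' hs (ρ := ρ') (fun z h1 h2 => ?_)
    have hz : Gp z = 0 := hK z h1 (by linarith)
    refine ⟨hz, hρ' z ?_⟩
    have hHz : Gp (H z) < c := by rw [P.plus.G_H, hz, mul_zero]; exact hc
    have hback : Hinv (ψ (φ (H z))) = z := by rw [b.ψφ _ hHz, P.plus.left]
    have hwV : φ (H z) ∈ V := by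
      refine ⟨b.mφ _ hHz, ?_⟩
      rw [hback]
      exact ⟨h1, h2⟩
    have e0 := hV0 _ hwV
    have e1 := hV1 _ hwV
    refine ⟨φ (H z), ⟨⟨e1, e0⟩, ?_⟩, hback⟩
    rw [mem_closedBall_zero_iff]
    exact hρ _ e1 e0

lemma Bih.symm (b : Bih φ ψ Gp Gm c c') :
    Bih (sw ψ) (sw φ) (fun z => Gm z.swap) (fun z => Gp z.swap) c' c := by
  have hsw : Differentiable ℂ (Prod.swap : ℂ × ℂ → ℂ × ℂ) := by
    have : Differentiable ℂ (fun z : ℂ × ℂ => (z.2, z.1)) := by fun_prop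
    exact this
  refine ⟨?_, ?_, ?_, ?_, ?_, ?_⟩
  · exact hsw.comp_differentiableOn (b.dψ.comp hsw.differentiableOn (fun z hz => hz))
  · exact hsw.comp_differentiableOn (b.dφ.comp hsw.differentiableOn (fun z hz => hz))
  · intro z hz
    simpa [sw] using b.mψ _ hz
  · intro z hz
    simpa [sw] using b.mφ _ hz
  · intro z hz
    simp [sw, b.φψ _ hz]
  · intro z hz
    simp [sw, b.ψφ _ hz]

end

end HenonAux

/-- Let `c, c' > 0` and suppose `φ : Ω_c → Ω⁻_{c'}` is a biholomorphism
from the forward Short ℂ², `Ω_c = {G⁺_H < c}`, onto the backward Short ℂ²,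
`Ω⁻_{c'} = {G⁻_H < c'}`. Then `φ(K⁺) = K⁻`. -/
theorem stmt_18 (d : ℕ) (hd : 2 ≤ d) (a : ℂ) (ha : a ≠ 0)
    (p : Polynomial ℂ) (hpm : p.Monic) (hpd : p.natDegree = d)
    (hpc : p.coeff (d - 1) = 0)
    (H : ℂ × ℂ → ℂ × ℂ) (hH : ∀ z : ℂ × ℂ, H z = (z.2, p.eval z.2 - a * z.1))
    (Hinv : ℂ × ℂ → ℂ × ℂ)
    (hHinv : ∀ z : ℂ × ℂ, Hinv z = ((p.eval z.1 - z.2) / a, z.1))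
    (Gp Gm : ℂ × ℂ → ℝ)
    (hGpcont : Continuous Gp) (hGpnonneg : ∀ z, 0 ≤ Gp z)
    (hGplim : ∀ z : ℂ × ℂ,
      Tendsto (fun n : ℕ => Real.log (max ‖H^[n] z‖ 1) / (d : ℝ) ^ n) atTop (𝓝 (Gp z)))
    (hGmcont : Continuous Gm) (hGmnonneg : ∀ z, 0 ≤ Gm z)
    (hGmlim : ∀ z : ℂ × ℂ,
      Tendsto (fun n : ℕ => Real.log (max ‖Hinv^[n] z‖ 1) / (d : ℝ) ^ n) atTop
        (𝓝 (Gm z)))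
    (Kp Km : Set (ℂ × ℂ))
    (hKp : Kp = {z : ℂ × ℂ | Bornology.IsBounded (Set.range fun n : ℕ => H^[n] z)})
    (hKm : Km = {z : ℂ × ℂ | Bornology.IsBounded (Set.range fun n : ℕ => Hinv^[n] z)})
    (hKpG : Kp = {z : ℂ × ℂ | Gp z = 0})
    (hKmG : Km = {z : ℂ × ℂ | Gm z = 0})
    (c c' : ℝ) (hc : 0 < c) (hc' : 0 < c')
    (φ ψ : ℂ × ℂ → ℂ × ℂ)
    (hφ : IsBiholoOn φ ψ {z : ℂ × ℂ | Gp z < c} {z : ℂ × ℂ | Gm z < c'}) :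
    φ '' Kp = Km := by
  have hen : HenonAux.Hen d a p H Hinv Gp :=
    ⟨hd, ha, hpd, hH, hHinv, hGpcont, hGpnonneg, hGplim, fun z => by
      have e : z ∈ Kp ↔ z ∈ Kp := Iff.rfl
      nth_rewrite 1 [hKpG] at e
      rw [hKp] at e
      exact e⟩
  have P : HenonAux.Pair d a p H Hinv Gp Gm :=
    HenonAux.Pair.mk' hen hGmcont hGmnonneg hGmlim (fun z => by
      have e : z ∈ Km ↔ z ∈ Km := Iff.rfl
      nth_rewrite 1 [hKmG] at e
      rw [hKm] at e
      exact e)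
  obtain ⟨h1, h2, h3, h4, h5, h6⟩ := hφ
  have b : HenonAux.Bih φ ψ Gp Gm c c' := ⟨h1, h2, h3, h4, h5, h6⟩
  rw [hKpG, hKmG]
  apply Set.Subset.antisymm
  · rintro _ ⟨z, hz, rfl⟩
    exact b.main P hc hc' hz
  · intro w hw
    have hw0 : Gm w = 0 := hw
    have hwc : Gm w < c' := by rw [hw0]; exact hc'
    have key := b.symm.main P.symm hc' hc (z0 := w.swap) (by simpa using hw0)
    simp only [HenonAux.sw, Prod.swap_swap] at key
    exact ⟨ψ w, key, h6 w hwc⟩
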